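/- arXiv:1609.04362 — 2 statements merged into one kernel-verified Lean document; each statement's English description precedes it below -/
import Mathlib

section
/- For i = 1,2 let (L_i,Δ_i,S_i) be a locality and let (L,Δ,S) = (L_1 × L_2, Δ_1*Δ_2, S_1 × S_2) be the external direct product of these localities. Let P ≤ S = S_1 × S_2 be a subgroup and set P_i := Pπ_i, where π_i : L_1 × L_2 → L_i is the projection map. Then: (a) N_L(P) ⊆ N_{L_1}(P_1) × N_{L_2}(P_2); (b) if P = P_1 × P_2 then N_L(P) = N_{L_1}(P_1) × N_{L_2}(P_2) as sets; (c) if P ∈ Δ, then P_i ∈ Δ_i for i = 1,2 (so in particular P_1 × P_2 ∈ Δ), and if the groups N_{L_1}(P_1) and N_{L_2}(P_2) are of characteristic p then N_L(P) is of characteristic p; (d) if P = P_1 × P_2 ∈ Δ, then N_L(P) is of characteristic p if and only if N_{L_i}(P_i) is of characteristic p for i = 1,2. -/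
/-!
Background definitions for partial groups and localities in the sense of Chermak.

A *partial group* is given by `Data`: a domain `D` of words, a (total, but only
meaningful on `D`) product `pi : List L → L`, and an inversion map, subject to the
axioms collected in `IsPartialGroup`.
-/

namespace PartialGroups

/-- The underlying data of a partial group. -/
structure Data (L : Type*) where
  /-- The domain of the product, a set of words. -/
  D : Set (List L)
  /-- The product `Π`, meaningful on `D`. -/
  pi : List L → L
  /-- The inversion map. -/
  inv : L → L

variable {L L' L₁ L₂ L₁' L₂' : Type*}

/-- The formal inverse of a word: `(f₁,…,fₙ)⁻¹ = (fₙ⁻¹,…,f₁⁻¹)`. -/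
def Data.wInv (P : Data L) (w : List L) : List L := (w.map P.inv).reverse

/-- The identity element `1 = Π(∅)`. -/
def Data.one (P : Data L) : L := P.pi []

/-- The axioms of a partial group. -/
structure IsPartialGroup (P : Data L) : Prop where
  /-- Inversion is an involution (in particular a bijection). -/
  inv_inv : ∀ f : L, P.inv (P.inv f) = f
  /-- `L ⊆ D` (words of length one lie in the domain). -/
  singleton_mem : ∀ f : L, [f] ∈ P.D
  /-- `u ∘ v ∈ D` implies `u ∈ D`. -/
  append_left : ∀ u v : List L, u ++ v ∈ P.D → u ∈ P.D
  /-- `u ∘ v ∈ D` implies `v ∈ D`. -/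
  append_right : ∀ u v : List L, u ++ v ∈ P.D → v ∈ P.D
  /-- `Π` restricts to the identity on words of length one. -/
  pi_singleton : ∀ f : L, P.pi [f] = f
  /-- `u ∘ v ∘ w ∈ D` implies `u ∘ (Π(v)) ∘ w ∈ D`. -/
  assoc_mem : ∀ u v w : List L, u ++ v ++ w ∈ P.D → u ++ [P.pi v] ++ w ∈ P.D
  /-- `Π(u ∘ v ∘ w) = Π(u ∘ (Π(v)) ∘ w)`. -/
  assoc_pi : ∀ u v w : List L, u ++ v ++ w ∈ P.D →
    P.pi (u ++ v ++ w) = P.pi (u ++ [P.pi v] ++ w)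
  /-- `w ∈ D` implies `w⁻¹ ∘ w ∈ D`. -/
  wInv_mem : ∀ w ∈ P.D, P.wInv w ++ w ∈ P.D
  /-- `Π(w⁻¹ ∘ w) = 1`. -/
  wInv_pi : ∀ w ∈ P.D, P.pi (P.wInv w ++ w) = P.one

/-- `D(g)`: the set of `x` for which `x^g` is defined. -/
def Data.Dconj (P : Data L) (g : L) : Set L := {x | [P.inv g, x, g] ∈ P.D}

/-- Conjugation `x^g = Π(g⁻¹, x, g)`. -/
def Data.conj (P : Data L) (x g : L) : L := P.pi [P.inv g, x, g]

/-- `X^g = {x^g : x ∈ X}`. -/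
def Data.conjSet (P : Data L) (X : Set L) (g : L) : Set L := (fun x => P.conj x g) '' X

/-- `W(H)`: the set of words with all entries in `H`. -/
def Wrd (H : Set L) : Set (List L) := {w | ∀ x ∈ w, x ∈ H}

/-- The centralizer `C_L(X) = {g : x ∈ D(g) and x^g = x for all x ∈ X}`. -/
def Data.centralizer (P : Data L) (X : Set L) : Set L :=
  {g | ∀ x ∈ X, x ∈ P.Dconj g ∧ P.conj x g = x}

/-- The center `Z(L) = C_L(L)`. -/
def Data.center (P : Data L) : Set L := P.centralizer Set.univ

/-- The normalizer `N_L(X) = {g : X ⊆ D(g) and X^g = X}`. -/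
def Data.normalizer (P : Data L) (X : Set L) : Set L :=
  {g | X ⊆ P.Dconj g ∧ P.conjSet X g = X}

/-- The centralizer of `X` computed inside the partial subgroup `L₀`. -/
def Data.centralizerIn (P : Data L) (L₀ X : Set L) : Set L := L₀ ∩ P.centralizer X

/-- The center of the partial subgroup `L₀` (with its restricted partial product). -/
def Data.centerIn (P : Data L) (L₀ : Set L) : Set L := P.centralizerIn L₀ L₀

/-- The set product `XY = {Π(x,y) : x ∈ X, y ∈ Y, (x,y) ∈ D}`. -/
def Data.setMul (P : Data L) (X Y : Set L) : Set L :=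
  {z | ∃ x ∈ X, ∃ y ∈ Y, [x, y] ∈ P.D ∧ P.pi [x, y] = z}

/-- `S_g = {s ∈ S ∩ D(g) : s^g ∈ S}`. -/
def Data.SOf (P : Data L) (S : Set L) (g : L) : Set L :=
  {s | s ∈ S ∧ s ∈ P.Dconj g ∧ P.conj s g ∈ S}

/-- A partial subgroup: closed under inversion and under products of words in the domain. -/
def Data.IsPartialSubgroup (P : Data L) (H : Set L) : Prop :=
  (∀ f ∈ H, P.inv f ∈ H) ∧ ∀ w ∈ Wrd H ∩ P.D, P.pi w ∈ H

/-- A subgroup: a partial subgroup `H` with `W(H) ⊆ D`. -/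
def Data.IsSubgroup (P : Data L) (H : Set L) : Prop :=
  P.IsPartialSubgroup H ∧ Wrd H ⊆ P.D

/-- A `p`-subgroup: a subgroup whose order is a power of `p`. -/
def Data.IsPSubgroup (p : ℕ) (P : Data L) (H : Set L) : Prop :=
  P.IsSubgroup H ∧ ∃ n : ℕ, H.ncard = p ^ n

/-- A partial normal subgroup: `n^f ∈ N` for all `f ∈ L` and `n ∈ N ∩ D(f)`. -/
def Data.IsPartialNormal (P : Data L) (N : Set L) : Prop :=
  P.IsPartialSubgroup N ∧ ∀ f : L, ∀ n ∈ N, n ∈ P.Dconj f → P.conj n f ∈ N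

/-- A homomorphism of partial groups: `Dβ* ⊆ D'` and `Π'(vβ*) = (Π(v))β`. -/
def IsHom (P : Data L) (P' : Data L') (β : L → L') : Prop :=
  (∀ w ∈ P.D, w.map β ∈ P'.D) ∧ ∀ w ∈ P.D, P'.pi (w.map β) = β (P.pi w)

/-- A projection of partial groups: a homomorphism with `Dβ* = D'`. -/
def IsProjection (P : Data L) (P' : Data L') (β : L → L') : Prop :=
  IsHom P P' β ∧ ∀ w' ∈ P'.D, ∃ w ∈ P.D, w.map β = w'

/-- An isomorphism of partial groups: an injective projection. -/
def IsIsomorphism (P : Data L) (P' : Data L') (β : L → L') : Prop :=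
  IsProjection P P' β ∧ Function.Injective β

/-- The kernel `ker(β) = {f : fβ = 1'}`. -/
def pgKer (P : Data L) (P' : Data L') (β : L → L') : Set L := {f | β f = P'.one}

/-- `β` restricted to the partial subgroup `L₀` is a homomorphism of partial groups
(the source being `L₀` with the restricted product). -/
def IsHomBetween (P : Data L) (P' : Data L') (L₀ : Set L) (β : L → L') : Prop :=
  (∀ w ∈ P.D ∩ Wrd L₀, w.map β ∈ P'.D) ∧
    ∀ w ∈ P.D ∩ Wrd L₀, P'.pi (w.map β) = β (P.pi w)

/-- `β` restricted to a map `L₀ → L₀'` is a projection of partial groups between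
the restricted partial groups on `L₀` and `L₀'` (so `(D ∩ W(L₀))β* = D' ∩ W(L₀')`). -/
def IsProjBetween (P : Data L) (P' : Data L') (L₀ : Set L) (L₀' : Set L') (β : L → L') :
    Prop :=
  β '' L₀ = L₀' ∧ IsHomBetween P P' L₀ β ∧
    ∀ w' ∈ P'.D ∩ Wrd L₀', ∃ w ∈ P.D ∩ Wrd L₀, w.map β = w'

/-- `β` restricted to a map `L₀ → L₀'` is an isomorphism of partial groups. -/
def IsIsoBetween (P : Data L) (P' : Data L') (L₀ : Set L) (L₀' : Set L') (β : L → L') :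
    Prop :=
  IsProjBetween P P' L₀ L₀' β ∧ Set.InjOn β L₀

/-- `chainFrom P Δ w Q` means: the word `w` lies in `D_Δ` via the chain starting at
`P₀ = Q`, i.e. there are `P₀,…,Pₙ ∈ Δ` with `P_{i-1} ⊆ D(f_i)` and `P_{i-1}^{f_i} = P_i`. -/
def chainFrom (P : Data L) (Δ : Set (Set L)) : List L → Set L → Prop
  | [], _ => True
  | f :: w, Q => Q ⊆ P.Dconj f ∧ P.conjSet Q f ∈ Δ ∧ chainFrom P Δ w (P.conjSet Q f)

/-- The set of words `D_Δ`. -/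
def DDelta (P : Data L) (Δ : Set (Set L)) : Set (List L) :=
  {w | ∃ Q ∈ Δ, chainFrom P Δ w Q}

/-- `(L,Δ,S)` is a locality (for the prime `p`). -/
structure IsLocality (p : ℕ) (P : Data L) (Δ : Set (Set L)) (S : Set L) : Prop where
  isPartialGroup : IsPartialGroup P
  /-- `L` is finite as a set. -/
  finite : Finite L
  /-- `S` is a `p`-subgroup of `L`. -/
  pSubgroup : P.IsPSubgroup p S
  /-- `Δ` is nonempty. -/
  delta_nonempty : Δ.Nonempty
  /-- `Δ` is a set of subgroups of `S`. -/
  delta_subgroups : ∀ Q ∈ Δ, P.IsSubgroup Q ∧ Q ⊆ S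
  /-- (L1): `S` is maximal among the `p`-subgroups of `L`. -/
  s_maximal : ∀ T : Set L, P.IsPSubgroup p T → S ⊆ T → T = S
  /-- (L2): `D = D_Δ`. -/
  d_eq : P.D = DDelta P Δ
  /-- (L3): overgroups in `S` of conjugates of members of `Δ` lie in `Δ`. -/
  delta_closed : ∀ Q : Set L, P.IsSubgroup Q → Q ⊆ S →
    (∃ R ∈ Δ, ∃ g : L, R ⊆ P.Dconj g ∧ P.conjSet R g ⊆ Q) → Q ∈ Δ

/-- `(L₀,Δ,S)` is a locality, where `L₀` is a partial subgroup of the ambient partial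
group and `L₀` is regarded as a partial group with the restricted product.  All the
conditions are expressed via the ambient product (with which the restricted one
agrees on words in `W(L₀)`). -/
structure IsLocalityIn (p : ℕ) (P : Data L) (L₀ : Set L) (Δ : Set (Set L)) (S : Set L) :
    Prop where
  partialSubgroup : P.IsPartialSubgroup L₀
  /-- `L₀` is finite as a set. -/
  finite : L₀.Finite
  /-- `S` is a `p`-subgroup. -/
  pSubgroup : P.IsPSubgroup p S
  s_sub : S ⊆ L₀
  delta_nonempty : Δ.Nonempty
  delta_subgroups : ∀ Q ∈ Δ, P.IsSubgroup Q ∧ Q ⊆ S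
  /-- (L1) for the restriction. -/
  s_maximal : ∀ T : Set L, T ⊆ L₀ → P.IsPSubgroup p T → S ⊆ T → T = S
  /-- (L2) for the restriction. -/
  d_eq : ∀ w ∈ Wrd L₀, (w ∈ P.D ↔ w ∈ DDelta P Δ)
  /-- (L3) for the restriction. -/
  delta_closed : ∀ Q : Set L, P.IsSubgroup Q → Q ⊆ S →
    (∃ R ∈ Δ, ∃ g ∈ L₀, R ⊆ P.Dconj g ∧ P.conjSet R g ⊆ Q) → Q ∈ Δ

/-- `(L₀,Δ₀,S₀)` is a sublocality of a locality with Sylow subgroup `S`. -/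
def IsSubLocality (p : ℕ) (P : Data L) (S : Set L) (L₀ : Set L) (Δ₀ : Set (Set L))
    (S₀ : Set L) : Prop :=
  S₀ = S ∩ L₀ ∧ IsLocalityIn p P L₀ Δ₀ S₀

/-- A projection of localities: a projection of partial groups with `Δβ = Δ'`. -/
def IsLocalityProj (P : Data L) (P' : Data L') (Δ : Set (Set L)) (Δ' : Set (Set L'))
    (β : L → L') : Prop :=
  IsProjection P P' β ∧ Set.image β '' Δ = Δ'

/-- `β` restricted to `L₀ → L₀'` is a projection of localities. -/
def IsLocalityProjBetween (P : Data L) (P' : Data L') (L₀ : Set L) (Δ₀ : Set (Set L))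
    (L₀' : Set L') (Δ₀' : Set (Set L')) (β : L → L') : Prop :=
  IsProjBetween P P' L₀ L₀' β ∧ Set.image β '' Δ₀ = Δ₀'

/-- The right coset `Nf = {Π(n,f) : n ∈ N, (n,f) ∈ D}`. -/
def rightCoset (P : Data L) (N : Set L) (f : L) : Set L :=
  {y | ∃ n ∈ N, [n, f] ∈ P.D ∧ P.pi [n, f] = y}

/-- The data of the external direct product of two partial groups:  the domain consists
of the words whose words of first resp. second coordinates lie in the respective domains,
and the product and the inversion are computed coordinatewise. -/
def prodData (P₁ : Data L₁) (P₂ : Data L₂) : Data (L₁ × L₂) where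
  D := {u | u.map Prod.fst ∈ P₁.D ∧ u.map Prod.snd ∈ P₂.D}
  pi := fun u => (P₁.pi (u.map Prod.fst), P₂.pi (u.map Prod.snd))
  inv := fun f => (P₁.inv f.1, P₂.inv f.2)

/-- `Δ₁ * Δ₂`: the set of subgroups of `S₁ × S₂` containing some `P₁ × P₂` with
`P_i ∈ Δ_i`. -/
def deltaStar (P₁ : Data L₁) (P₂ : Data L₂) (Δ₁ : Set (Set L₁)) (Δ₂ : Set (Set L₂))
    (S₁ : Set L₁) (S₂ : Set L₂) : Set (Set (L₁ × L₂)) :=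
  {Q | (prodData P₁ P₂).IsSubgroup Q ∧ Q ⊆ S₁ ×ˢ S₂ ∧
    ∃ R₁ ∈ Δ₁, ∃ R₂ ∈ Δ₂, R₁ ×ˢ R₂ ⊆ Q}

/-- `K` is a normal `p`-subgroup of the subgroup `M` of the ambient partial group. -/
def Data.IsNormalPSubgroupIn (p : ℕ) (P : Data L) (M K : Set L) : Prop :=
  K ⊆ M ∧ P.IsSubgroup K ∧ (∃ n : ℕ, K.ncard = p ^ n) ∧
    ∀ f ∈ M, ∀ x ∈ K, x ∈ P.Dconj f ∧ P.conj x f ∈ K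

/-- `O_p(M)`: the largest normal `p`-subgroup of the subgroup `M` (the union of all
normal `p`-subgroups of `M`). -/
def Data.pCoreIn (p : ℕ) (P : Data L) (M : Set L) : Set L :=
  ⋃₀ {K | P.IsNormalPSubgroupIn p M K}

/-- The subgroup `M` of the ambient partial group is of characteristic `p`:
`C_M(O_p(M)) ≤ O_p(M)`. -/
def Data.IsCharPSubgroup (p : ℕ) (P : Data L) (M : Set L) : Prop :=
  P.centralizerIn M (P.pCoreIn p M) ⊆ P.pCoreIn p M

/-- A locality is of objective characteristic `p` if `N_L(Q)` is of characteristic `p`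
for every `Q ∈ Δ`. -/
def IsObjectiveCharP (p : ℕ) (P : Data L) (Δ : Set (Set L)) : Prop :=
  ∀ Q ∈ Δ, P.IsCharPSubgroup p (P.normalizer Q)

/-- The word `(Π(f₁,g₁),…,Π(fₙ,gₙ))` built from the words `u = (f₁,…,fₙ)` and
`v = (g₁,…,gₙ)`. -/
def zipProd (P : Data L) (u v : List L) : List L :=
  List.zipWith (fun f g => P.pi [f, g]) u v

/-- `L` is the internal central product of `M₁` and `M₂`: conditions (C1) and (C2). -/
def IsInternalCentralProduct (P : Data L) (M₁ M₂ : Set L) : Prop :=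
  (P.D = {w | ∃ u v : List L, u ∈ P.D ∩ Wrd M₁ ∧ v ∈ P.D ∩ Wrd M₂ ∧
      u.length = v.length ∧ (∀ q ∈ u.zip v, [q.1, q.2] ∈ P.D) ∧ w = zipProd P u v}) ∧
  ∀ u v : List L, u ∈ P.D ∩ Wrd M₁ → v ∈ P.D ∩ Wrd M₂ → u.length = v.length →
    (∀ q ∈ u.zip v, [q.1, q.2] ∈ P.D) →
    P.pi (zipProd P u v) = P.pi [P.pi u, P.pi v]

/-- `L` is the internal direct product of `M₁` and `M₂`: (C1), (C2) and (D). -/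
def IsInternalDirectProduct (P : Data L) (M₁ M₂ : Set L) : Prop :=
  IsInternalCentralProduct P M₁ M₂ ∧
    ∀ h : L, ∃! fg : L × L, fg.1 ∈ M₁ ∧ fg.2 ∈ M₂ ∧ [fg.1, fg.2] ∈ P.D ∧
      P.pi [fg.1, fg.2] = h

section FiniteGroups

variable {G H : Type*} [Group G] [Group H] {p : ℕ}

/-- Membership in `O_p(G)`, the union of all normal `p`-subgroups of `G`. -/
def InPCore (p : ℕ) (g : G) : Prop :=
  ∃ K : Subgroup G, K.Normal ∧ IsPGroup p K ∧ g ∈ K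

variable (G) in
/-- The group `G` is of characteristic `p`. -/
def IsGroupCharP (p : ℕ) : Prop :=
  ∀ g : G, (∀ x : G, InPCore p x → g⁻¹ * x * g = x) → InPCore p g

theorem inv_mul_mul_eq_iff_commute {a b : G} : b⁻¹ * a * b = a ↔ Commute a b := by
  rw [mul_assoc, inv_mul_eq_iff_eq_mul]
  exact Iff.rfl

theorem InPCore.map {f : G →* H} (hf : Function.Surjective f) {g : G}
    (hg : InPCore p g) : InPCore p (f g) := by
  obtain ⟨K, hK, hKp, hgK⟩ := hg
  exact ⟨K.map f, hK.map f hf, hKp.map f, g, hgK, rfl⟩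

theorem inPCore_prod_iff {g : G × H} :
    InPCore p g ↔ InPCore p g.1 ∧ InPCore p g.2 := by
  constructor
  · intro hg
    exact ⟨hg.map (f := MonoidHom.fst G H) Prod.fst_surjective,
      hg.map (f := MonoidHom.snd G H) Prod.snd_surjective⟩
  · rintro ⟨⟨K, hK, hKp, hgK⟩, K', hK', hKp', hgK'⟩
    refine ⟨K.prod K', Subgroup.prod_normal K K', ?_, hgK, hgK'⟩
    rintro ⟨⟨a, b⟩, ha, hb⟩
    obtain ⟨m, hm⟩ := hKp ⟨a, ha⟩
    obtain ⟨n, hn⟩ := hKp' ⟨b, hb⟩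
    refine ⟨m + n, ?_⟩
    simp only [Subtype.ext_iff, SubmonoidClass.coe_pow, OneMemClass.coe_one] at hm hn
    simp only [Subtype.ext_iff, SubmonoidClass.coe_pow, OneMemClass.coe_one, Prod.ext_iff,
      Prod.pow_fst, Prod.pow_snd, Prod.fst_one, Prod.snd_one]
    exact ⟨by rw [pow_add, pow_mul, hm, one_pow],
      by rw [add_comm, pow_add, pow_mul, hn, one_pow]⟩

theorem inPCore_one : InPCore p (1 : G) :=
  ⟨⊥, inferInstance, IsPGroup.of_bot, Subgroup.mem_bot.2 rfl⟩

theorem isGroupCharP_prod_iff :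
    IsGroupCharP (G × H) p ↔ IsGroupCharP G p ∧ IsGroupCharP H p := by
  constructor
  · intro h
    refine ⟨fun g hg => (inPCore_prod_iff.1 (h (g, 1) fun x hx => ?_)).1,
      fun g hg => (inPCore_prod_iff.1 (h (1, g) fun x hx => ?_)).2⟩
    · exact Prod.ext (hg _ (inPCore_prod_iff.1 hx).1) (by simp)
    · exact Prod.ext (by simp) (hg _ (inPCore_prod_iff.1 hx).2)
  · rintro ⟨h, h'⟩ g hg
    refine inPCore_prod_iff.2 ⟨h _ fun x hx => ?_, h' _ fun x hx => ?_⟩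
    · exact congrArg Prod.fst (hg (x, 1) (inPCore_prod_iff.2 ⟨hx, inPCore_one⟩))
    · exact congrArg Prod.snd (hg (1, x) (inPCore_prod_iff.2 ⟨inPCore_one, hx⟩))

/-- In a finite group, `O_p(G)` is itself a normal `p`-subgroup. -/
theorem exists_pCore [Finite G] (p : ℕ) :
    ∃ X : Subgroup G, X.Normal ∧ IsPGroup p X ∧ ∀ g, InPCore p g ↔ g ∈ X := by
  obtain ⟨X, ⟨hX, hXp⟩, hmax⟩ :=
    (Set.toFinite {K : Subgroup G | K.Normal ∧ IsPGroup p K}).exists_maximal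
      ⟨⊥, inferInstance, IsPGroup.of_bot⟩
  refine ⟨X, hX, hXp, fun g => ⟨?_, fun hg => ⟨X, hX, hXp, hg⟩⟩⟩
  rintro ⟨K, hK, hKp, hgK⟩
  exact hmax (y := X ⊔ K) ⟨inferInstance, hXp.to_sup_of_normal_left hKp⟩ le_sup_left
    (Subgroup.mem_sup_right hgK)

/-- A version of the Thompson `A × B` lemma: an element `c` of order prime to `p` normalizing a finite
`p`-group `T` and centralizing both `P ≤ T` and `C_T(P)` centralizes `T`. -/
theorem commute_of_coprime_of_commute_centralizer [Fact p.Prime] (T : Subgroup G) [Finite T]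
    (hT : IsPGroup p T) {P : Subgroup G} (hPT : P ≤ T) (c : G)
    (hc : (orderOf c).Coprime p) (hcT : ∀ t ∈ T, c * t * c⁻¹ ∈ T)
    (hcP : ∀ a ∈ P, Commute c a)
    (hcC : ∀ t ∈ T, (∀ a ∈ P, Commute t a) → Commute c t) :
    ∀ t ∈ T, Commute c t := by
  set R : Subgroup T := (Subgroup.centralizer {c}).subgroupOf T with hR
  have memR : ∀ t : T, t ∈ R ↔ Commute c t := fun t => by
    rw [hR, Subgroup.mem_subgroupOf, Subgroup.mem_centralizer_singleton_iff]
    exact ⟨fun h => Eq.symm h, fun h => Eq.symm h⟩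
  have hnil : Group.IsNilpotent T := hT.isNilpotent
  have hself : Subgroup.normalizer (R : Set T) = R := by
    refine le_antisymm (fun n hn => ?_) Subgroup.le_normalizer
    rw [Subgroup.mem_normalizer_iff''] at hn
    set z : G := c * n * c⁻¹ * (n : G)⁻¹ with hz
    have hzT : z ∈ T := T.mul_mem (hcT _ n.2) (T.inv_mem n.2)
    have hzc : Commute c z := by
      refine hcC z hzT fun a ha => ?_
      have hb := (memR _).1 ((hn ⟨a, hPT ha⟩).1 ((memR _).2 (hcP a ha)))
      simp only [Subgroup.coe_mul, InvMemClass.coe_inv] at hb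
      have hb' : c⁻¹ * ((n : G)⁻¹ * a * n) * c = (n : G)⁻¹ * a * n :=
        inv_mul_mul_eq_iff_commute.2 hb.symm
      have h1 : c * a * c⁻¹ = a := by rw [(hcP a ha).eq]; group
      have key : z * a * z⁻¹ = a := by
        calc z * a * z⁻¹
            = c * n * (c⁻¹ * ((n : G)⁻¹ * a * n) * c) * (n : G)⁻¹ * c⁻¹ := by
              rw [hz]; group
          _ = c * a * c⁻¹ := by rw [hb']; group
          _ = a := h1
      exact mul_inv_eq_iff_eq_mul.1 key
    have hconj : ∀ k : ℕ, c ^ k * n = z ^ k * n * c ^ k := by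
      intro k
      induction k with
      | zero => simp
      | succ k ih =>
        calc c ^ (k + 1) * n = c * (c ^ k * n) := by rw [pow_succ']; group
          _ = (c * z ^ k) * n * c ^ k := by rw [ih]; group
          _ = z ^ k * (c * n) * c ^ k := by rw [(hzc.pow_right k).eq]; group
          _ = z ^ k * (z * n * c) * c ^ k := by rw [hz]; group
          _ = z ^ (k + 1) * n * c ^ (k + 1) := by
            rw [pow_succ z, pow_succ' c]; group
    have hzpow : z ^ orderOf c = 1 := by
      have := hconj (orderOf c)
      rw [pow_orderOf_eq_one] at this
      simpa using this.symm
    have hz1 : z = 1 := by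
      obtain ⟨k, hk⟩ := hT ⟨z, hzT⟩
      simp only [Subtype.ext_iff, SubmonoidClass.coe_pow, OneMemClass.coe_one] at hk
      have := Nat.dvd_gcd (orderOf_dvd_of_pow_eq_one hzpow) (orderOf_dvd_of_pow_eq_one hk)
      rw [(hc.pow_right k).gcd_eq_one] at this
      exact orderOf_eq_one_iff.1 (Nat.dvd_one.1 this)
    rw [memR]
    have := hconj 1
    rwa [hz1, one_pow, one_mul, pow_one] at this
  have htop := normalizerCondition_iff_only_full_group_self_normalizing.1
    Group.normalizerCondition_of_isNilpotent R hself
  intro t ht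
  exact (memR ⟨t, ht⟩).1 (htop ▸ Subgroup.mem_top _)

/-- The normalizer of a `p`-subgroup in a finite group of characteristic `p` is of
characteristic `p`. -/
theorem IsGroupCharP.normalizer [Finite G] [Fact p.Prime] (h : IsGroupCharP G p)
    (P : Subgroup G) (hP : IsPGroup p P) :
    IsGroupCharP (Subgroup.normalizer (P : Set G)) p := by
  set N := Subgroup.normalizer (P : Set G)
  obtain ⟨X, hX, hXp, hXmem⟩ := exists_pCore (G := G) p
  obtain ⟨Y, hY, hYp, hYmem⟩ := exists_pCore (G := N) p
  have hC : ∀ c ∈ Subgroup.centralizer (Y : Set N), (orderOf c).Coprime p → c = 1 := by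
    intro c hc hcop
    have hcY : ∀ y : N, InPCore p y → Commute (c : G) y := fun y hy =>
      congrArg Subtype.val (Subgroup.mem_centralizer_iff.1 hc y ((hYmem y).1 hy)).symm
    have hPle : P ≤ N := Subgroup.le_normalizer
    have hcP : ∀ a ∈ P, Commute (c : G) a := fun a ha =>
      hcY ⟨a, hPle ha⟩ ⟨P.subgroupOf N, Subgroup.normal_in_normalizer, hP.comap_subtype, ha⟩
    have hcX : ∀ x ∈ X, x ∈ N → Commute (c : G) x := fun x hx hxN =>
      hcY ⟨x, hxN⟩ ⟨X.subgroupOf N, inferInstance, hXp.comap_subtype, hx⟩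
    have hcop' : (orderOf (c : G)).Coprime p := by rwa [Subgroup.orderOf_coe]
    have hall : ∀ t ∈ X ⊔ P, Commute (c : G) t := by
      refine commute_of_coprime_of_commute_centralizer (X ⊔ P) (hXp.to_sup_of_normal_left hP)
        le_sup_right c hcop' ?_ hcP ?_
      · intro t ht
        obtain ⟨x, hx, a, ha, rfl⟩ := Subgroup.mem_sup_of_normal_left.1 ht
        refine Subgroup.mem_sup_of_normal_left.2 ⟨c * x * (c : G)⁻¹, hX.conj_mem x hx c, a, ha, ?_⟩
        have : (c : G)⁻¹ * a = a * (c : G)⁻¹ := ((hcP a ha).inv_left).eq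
        simp only [mul_assoc, this]
      · intro t ht htP
        have htN : t ∈ N := Subgroup.centralizer_le_normalizer _
          (Subgroup.mem_centralizer_iff.2 fun a ha => (htP a ha).eq.symm)
        obtain ⟨x, hx, a, ha, rfl⟩ := Subgroup.mem_sup_of_normal_left.1 ht
        have hxN : x ∈ N := (Subgroup.mul_mem_cancel_right N (hPle ha)).1 htN
        exact (hcX x hx hxN).mul_right (hcP a ha)
    have hcp : (c : G) ∈ X := by
      rw [← hXmem]
      refine h _ fun x hx => inv_mul_mul_eq_iff_commute.2 ?_
      exact (hall x (Subgroup.mem_sup_left ((hXmem x).1 hx))).symm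
    obtain ⟨k, hk⟩ := hXp ⟨c, hcp⟩
    simp only [Subtype.ext_iff, SubmonoidClass.coe_pow, OneMemClass.coe_one] at hk
    have := Nat.dvd_gcd dvd_rfl (orderOf_dvd_of_pow_eq_one hk)
    rw [(hcop'.pow_right k).gcd_eq_one] at this
    exact Subtype.ext (orderOf_eq_one_iff.1 (Nat.dvd_one.1 this))
  intro g hg
  refine ⟨Subgroup.centralizer (Y : Set N), inferInstance, ?_, ?_⟩
  · rintro ⟨c, hc⟩
    obtain ⟨k, m, hm, hkm⟩ := Nat.exists_eq_pow_mul_and_not_dvd (orderOf_pos c).ne' p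
      (Fact.out : p.Prime).ne_one
    refine ⟨k, Subtype.ext (hC _ (pow_mem hc _) ?_)⟩
    have : orderOf (c ^ p ^ k) = m := by
      rw [orderOf_pow_of_dvd (pow_ne_zero _ (Fact.out : p.Prime).ne_zero)
        (hkm ▸ dvd_mul_right _ _), hkm,
        Nat.mul_div_cancel_left _ (pow_pos (Fact.out : p.Prime).pos _)]
    rw [SubmonoidClass.coe_pow, this]
    exact ((Nat.Prime.coprime_iff_not_dvd Fact.out).2 hm).symm
  · refine Subgroup.mem_centralizer_iff.2 fun y hy => ?_
    exact inv_mul_mul_eq_iff_commute.1 (hg y ((hYmem y).2 hy))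

end FiniteGroups

section PartialGroupLemmas

variable {P : Data L}

theorem IsPartialGroup.wInv_mem_D (hP : IsPartialGroup P) {w : List L} (hw : w ∈ P.D) :
    P.wInv w ∈ P.D :=
  hP.append_left _ _ (hP.wInv_mem w hw)

theorem IsPartialGroup.wInv_wInv (hP : IsPartialGroup P) (w : List L) :
    P.wInv (P.wInv w) = w := by
  have : P.inv ∘ P.inv = id := funext hP.inv_inv
  simp [Data.wInv, this]

theorem IsPartialGroup.append_wInv_mem (hP : IsPartialGroup P) {w : List L} (hw : w ∈ P.D) :
    w ++ P.wInv w ∈ P.D := by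
  simpa [hP.wInv_wInv] using hP.wInv_mem _ (hP.wInv_mem_D hw)

theorem IsPartialGroup.one_cons (hP : IsPartialGroup P) {w : List L} (hw : w ∈ P.D) :
    P.one :: w ∈ P.D ∧ P.pi (P.one :: w) = P.pi w := by
  have h : [] ++ [] ++ w ∈ P.D := by simpa using hw
  exact ⟨by simpa [Data.one] using hP.assoc_mem [] [] w h,
    by simpa [Data.one] using (hP.assoc_pi [] [] w h).symm⟩

theorem IsPartialGroup.append_one (hP : IsPartialGroup P) {w : List L} (hw : w ∈ P.D) :
    w ++ [P.one] ∈ P.D ∧ P.pi (w ++ [P.one]) = P.pi w := by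
  have h : w ++ [] ++ [] ∈ P.D := by simpa using hw
  exact ⟨by simpa [Data.one] using hP.assoc_mem w [] [] h,
    by simpa [Data.one] using (hP.assoc_pi w [] [] h).symm⟩

theorem IsPartialGroup.pi_cons (hP : IsPartialGroup P) {f : L} {w : List L}
    (hw : f :: w ∈ P.D) : [f, P.pi w] ∈ P.D ∧ P.pi (f :: w) = P.pi [f, P.pi w] := by
  have h : [f] ++ w ++ [] ∈ P.D := by simpa using hw
  exact ⟨by simpa using hP.assoc_mem [f] w [] h, by simpa using hP.assoc_pi [f] w [] h⟩

theorem IsPartialGroup.pi_append (hP : IsPartialGroup P) {u v : List L}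
    (h : u ++ v ∈ P.D) : [P.pi u, P.pi v] ∈ P.D ∧ P.pi (u ++ v) = P.pi [P.pi u, P.pi v] := by
  have h₁ : u ++ v ++ [] ∈ P.D := by simpa using h
  have h₂ : [] ++ u ++ [P.pi v] ∈ P.D := by simpa using hP.assoc_mem u v [] h₁
  refine ⟨by simpa using hP.assoc_mem [] u [P.pi v] h₂, ?_⟩
  have e₁ := hP.assoc_pi u v [] h₁
  have e₂ := hP.assoc_pi [] u [P.pi v] h₂
  simp only [List.append_nil, List.nil_append, List.singleton_append] at e₁ e₂
  rw [e₁, e₂]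

theorem IsPartialGroup.inv_one (hP : IsPartialGroup P) : P.inv P.one = P.one := by
  have h := hP.wInv_pi _ (hP.singleton_mem P.one)
  have h' : P.pi ([P.inv P.one] ++ [P.one]) = P.one := by simpa [Data.wInv] using h
  rwa [(hP.append_one (hP.singleton_mem _)).2, hP.pi_singleton] at h'

theorem IsPartialGroup.conj_one (hP : IsPartialGroup P) (x : L) :
    x ∈ P.Dconj P.one ∧ P.conj x P.one = x := by
  have h₁ := hP.append_one (hP.singleton_mem x)
  have h₂ := hP.one_cons h₁.1
  rw [h₁.2, hP.pi_singleton] at h₂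
  simpa [Data.Dconj, Data.conj, hP.inv_one] using h₂

theorem IsPartialGroup.pi_inv_self (hP : IsPartialGroup P) (f : L) :
    P.pi [P.inv f, f] = P.one := by
  simpa [Data.wInv] using hP.wInv_pi _ (hP.singleton_mem f)

theorem IsPartialGroup.pi_self_inv (hP : IsPartialGroup P) (f : L) :
    P.pi [f, P.inv f] = P.one := by
  simpa [hP.inv_inv] using hP.pi_inv_self (P.inv f)

theorem IsPartialGroup.pi_wInv (hP : IsPartialGroup P) {w : List L} (hw : w ∈ P.D) :
    P.pi (P.wInv w) = P.inv (P.pi w) := by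
  set a := P.pi w
  have h₁ : P.wInv w ++ w ++ [] ∈ P.D := by simpa using hP.wInv_mem w hw
  have h₂ : P.wInv w ++ [a] ∈ P.D := by simpa using hP.assoc_mem _ _ _ h₁
  have e₂ : P.pi (P.wInv w ++ [a]) = P.one := by
    rw [← hP.wInv_pi w hw]
    simpa using (hP.assoc_pi _ _ _ h₁).symm
  have h₃ : (P.wInv w ++ [a]) ++ [P.inv a] ∈ P.D := by
    refine hP.append_left _ (P.wInv (P.wInv w)) ?_
    simpa [Data.wInv] using hP.append_wInv_mem h₂
  have h₄ : P.wInv w ++ [a, P.inv a] ++ [] ∈ P.D := by simpa using h₃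
  have e₃ := (hP.pi_append h₃).2
  rw [e₂, hP.pi_singleton, (hP.one_cons (hP.singleton_mem _)).2, hP.pi_singleton] at e₃
  have e₄ := hP.assoc_pi _ _ _ h₄
  rw [hP.pi_self_inv, List.append_nil, List.append_nil,
    (hP.append_one (hP.wInv_mem_D hw)).2] at e₄
  rw [← e₃, ← e₄]
  simp

theorem IsPartialGroup.conj_inv (hP : IsPartialGroup P) {x g : L} (hx : x ∈ P.Dconj g) :
    P.conj x g ∈ P.Dconj (P.inv g) ∧ P.conj (P.conj x g) (P.inv g) = x := by
  have h₁ : [g, P.inv g, x, g] ∈ P.D := by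
    refine hP.append_right [P.inv g, P.inv x] _ ?_
    simpa [Data.wInv, hP.inv_inv] using hP.wInv_mem _ hx
  have h₂ : [g, P.inv g, x, g, P.inv g] ∈ P.D := by
    refine hP.append_left _ [P.inv x, g, P.inv g] ?_
    simpa [Data.wInv, hP.inv_inv] using hP.append_wInv_mem h₁
  have h₃ : [g] ++ [P.inv g, x, g] ++ [P.inv g] ∈ P.D := h₂
  refine ⟨by simpa [Data.Dconj, Data.conj, hP.inv_inv] using hP.assoc_mem _ _ _ h₃, ?_⟩
  have e : P.conj (P.conj x g) (P.inv g) = P.pi [g, P.inv g, x, g, P.inv g] := by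
    simpa [Data.conj, hP.inv_inv] using (hP.assoc_pi _ _ _ h₃).symm
  have h₄ : [] ++ [g, P.inv g] ++ [x, g, P.inv g] ∈ P.D := h₂
  have e₄ := hP.assoc_pi _ _ _ h₄
  have h₅ : [x] ++ [g, P.inv g] ++ [] ∈ P.D := hP.append_right [g, P.inv g] _ h₂
  have e₅ := hP.assoc_pi _ _ _ h₅
  rw [hP.pi_self_inv] at e₄ e₅
  rw [e]
  calc P.pi [g, P.inv g, x, g, P.inv g] = P.pi (P.one :: [x, g, P.inv g]) := e₄
    _ = P.pi [x, g, P.inv g] := (hP.one_cons h₅).2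
    _ = P.pi ([x] ++ [P.one]) := e₅
    _ = x := by rw [(hP.append_one (hP.singleton_mem x)).2, hP.pi_singleton]

theorem IsPartialGroup.conj_pi_pair (hP : IsPartialGroup P) {f g x : L}
    (h : [P.inv g, P.inv f, x, f, g] ∈ P.D) :
    x ∈ P.Dconj (P.pi [f, g]) ∧ P.conj x (P.pi [f, g]) = P.conj (P.conj x f) g := by
  have hfg : [f, g] ∈ P.D := hP.append_right [P.inv g, P.inv f, x] _ h
  have hinv : P.inv (P.pi [f, g]) = P.pi [P.inv g, P.inv f] := by
    rw [← hP.pi_wInv hfg]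
    simp [Data.wInv]
  have h₁ : [P.inv g] ++ [P.inv f, x, f] ++ [g] ∈ P.D := h
  have h₂ : [P.inv g, P.inv f, x] ++ [f, g] ++ [] ∈ P.D := h
  have h₃ : [] ++ [P.inv g, P.inv f] ++ [x, P.pi [f, g]] ∈ P.D := hP.assoc_mem _ _ _ h₂
  refine ⟨?_, ?_⟩
  · change [P.inv (P.pi [f, g]), x, P.pi [f, g]] ∈ P.D
    rw [hinv]
    exact hP.assoc_mem _ _ _ h₃
  · rw [Data.conj, hinv]
    exact (hP.assoc_pi _ _ _ h₃).symm.trans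
      ((hP.assoc_pi _ _ _ h₂).symm.trans (hP.assoc_pi _ _ _ h₁))

theorem exists_map_eq_of_mem_wrd (φ : L → L') (K : Set L) {w : List L'}
    (hw : w ∈ Wrd (φ '' K)) : ∃ v ∈ Wrd K, v.map φ = w := by
  induction w with
  | nil => exact ⟨[], by simp [Wrd], rfl⟩
  | cons a w ih =>
    obtain ⟨v, hv, rfl⟩ := ih fun x hx => hw x (by simp [hx])
    obtain ⟨k, hk, rfl⟩ := hw a (by simp)
    exact ⟨k :: v, by simpa [Wrd, hk] using hv, rfl⟩

theorem mem_normalizer_of {Q : Set L} {g : L} (h : ∀ x ∈ Q, x ∈ P.Dconj g ∧ P.conj x g ∈ Q)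
    (h' : ∀ y ∈ Q, ∃ x ∈ Q, P.conj x g = y) : g ∈ P.normalizer Q :=
  ⟨fun x hx => (h x hx).1, Set.Subset.antisymm (Set.image_subset_iff.2 fun x hx => (h x hx).2) h'⟩

theorem conj_mem_of_mem_normalizer {Q : Set L} {g x : L} (hg : g ∈ P.normalizer Q)
    (hx : x ∈ Q) : P.conj x g ∈ Q :=
  hg.2.subset ⟨x, hx, rfl⟩

theorem IsPartialGroup.inv_mem_normalizer (hP : IsPartialGroup P) {Q : Set L} {g : L}
    (hg : g ∈ P.normalizer Q) : P.inv g ∈ P.normalizer Q := by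
  refine mem_normalizer_of (fun x hx => ?_) fun y hy =>
    ⟨P.conj y g, conj_mem_of_mem_normalizer hg hy, (hP.conj_inv (hg.1 hy)).2⟩
  obtain ⟨y, hy, rfl⟩ := hg.2.superset hx
  have := hP.conj_inv (hg.1 hy)
  exact ⟨this.1, this.2.symm ▸ hy⟩

theorem Data.IsSubgroup.one_mem {Q : Set L} (hQ : P.IsSubgroup Q) : P.one ∈ Q :=
  hQ.1.2 [] ⟨by simp [Wrd], hQ.2 (by simp [Wrd])⟩

theorem Data.IsSubgroup.pi_mem {Q : Set L} (hQ : P.IsSubgroup Q) {w : List L}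
    (hw : w ∈ Wrd Q) : P.pi w ∈ Q :=
  hQ.1.2 w ⟨hw, hQ.2 hw⟩

theorem Data.IsSubgroup.subset_normalizer (hP : IsPartialGroup P) {Q : Set L}
    (hQ : P.IsSubgroup Q) : Q ⊆ P.normalizer Q := by
  have key : ∀ q ∈ Q, ∀ x ∈ Q, x ∈ P.Dconj q ∧ P.conj x q ∈ Q := fun q hq x hx => by
    have hw : [P.inv q, x, q] ∈ Wrd Q := by simp [Wrd, hq, hx, hQ.1.1 q hq]
    exact ⟨hQ.2 hw, hQ.pi_mem hw⟩
  intro q hq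
  refine mem_normalizer_of (key q hq) fun y hy => ?_
  have hy' := key _ (hQ.1.1 q hq) y hy
  exact ⟨_, hy'.2, by simpa [hP.inv_inv] using (hP.conj_inv hy'.1).2⟩

/-- In a locality, the normalizer of an object is a subgroup. -/
theorem IsLocality.isSubgroup_normalizer {p : ℕ} {Δ : Set (Set L)} {S : Set L}
    (h : IsLocality p P Δ S) {Q : Set L} (hQ : Q ∈ Δ) : P.IsSubgroup (P.normalizer Q) := by
  have hP := h.isPartialGroup
  have hchain : ∀ w ∈ Wrd (P.normalizer Q), chainFrom P Δ w Q := by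
    intro w
    induction w with
    | nil => exact fun _ => trivial
    | cons f w ih =>
      intro hw
      have hf := hw f (by simp)
      refine ⟨hf.1, ?_, ?_⟩
      · rwa [hf.2]
      · rw [hf.2]
        exact ih fun x hx => hw x (by simp [hx])
  have hD : Wrd (P.normalizer Q) ⊆ P.D := fun w hw => h.d_eq ▸ ⟨Q, hQ, hchain w hw⟩
  have hQN := (h.delta_subgroups Q hQ).1.subset_normalizer hP
  have hmul : ∀ f ∈ P.normalizer Q, ∀ g ∈ P.normalizer Q, P.pi [f, g] ∈ P.normalizer Q := by
    intro f hf g hg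
    have key : ∀ x ∈ Q, x ∈ P.Dconj (P.pi [f, g]) ∧
        P.conj x (P.pi [f, g]) = P.conj (P.conj x f) g := fun x hx =>
      hP.conj_pi_pair <| hD <| by
        simp [Wrd, hf, hg, hQN hx, hP.inv_mem_normalizer hf, hP.inv_mem_normalizer hg]
    refine mem_normalizer_of (fun x hx => ⟨(key x hx).1, ?_⟩) fun y hy => ?_
    · rw [(key x hx).2]
      exact conj_mem_of_mem_normalizer hg (conj_mem_of_mem_normalizer hf hx)
    · obtain ⟨z, hz, rfl⟩ := hg.2.superset hy
      obtain ⟨x, hx, rfl⟩ := hf.2.superset hz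
      exact ⟨x, hx, (key x hx).2⟩
  have hone : P.one ∈ P.normalizer Q :=
    mem_normalizer_of (fun x hx => ⟨(hP.conj_one x).1, (hP.conj_one x).2.symm ▸ hx⟩)
      fun y hy => ⟨y, hy, (hP.conj_one y).2⟩
  refine ⟨⟨fun f hf => hP.inv_mem_normalizer hf, fun w hw => ?_⟩, hD⟩
  replace hw := hw.1
  induction w with
  | nil => exact hone
  | cons f w ih =>
    rw [(hP.pi_cons (hD hw)).2]
    exact hmul _ (hw f (by simp)) _ (ih fun x hx => hw x (by simp [hx]))

theorem IsLocality.mem_of_subset {p : ℕ} {Δ : Set (Set L)} {S : Set L}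
    (h : IsLocality p P Δ S) {R Q : Set L} (hR : R ∈ Δ) (hRQ : R ⊆ Q)
    (hQ : P.IsSubgroup Q) (hQS : Q ⊆ S) : Q ∈ Δ := by
  have hc := h.isPartialGroup.conj_one
  refine h.delta_closed Q hQ hQS ⟨R, hR, P.one, fun x _ => (hc x).1, ?_⟩
  rintro _ ⟨x, hx, rfl⟩
  exact hRQ (by simpa only [(hc x).2] using hx)

end PartialGroupLemmas

section Models

variable {G H : Type*} [Group G] [Group H] {P : Data L} {φ : G → L} {p : ℕ}

/-- `φ` embeds the group `G` into the partial group as a subgroup. -/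
structure Models (P : Data L) (φ : G → L) : Prop where
  injective : Function.Injective φ
  mem_D : ∀ w : List G, w.map φ ∈ P.D
  pi_map : ∀ w : List G, P.pi (w.map φ) = φ w.prod
  inv_map : ∀ g : G, P.inv (φ g) = φ g⁻¹

theorem Data.IsSubgroup.exists_models (hP : IsPartialGroup P) {M : Set L}
    (hM : P.IsSubgroup M) : ∃ _ : Group M, Models P (Subtype.val : M → L) := by
  have hD : ∀ w : List M, w.map Subtype.val ∈ P.D := fun w => hM.2 <| by
    intro x hx
    obtain ⟨y, -, rfl⟩ := List.mem_map.1 hx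
    exact y.2
  let _ : Mul M := ⟨fun a b => ⟨P.pi [a, b], hM.pi_mem (by simp [Wrd])⟩⟩
  let _ : One M := ⟨⟨P.one, hM.one_mem⟩⟩
  let _ : Inv M := ⟨fun a => ⟨P.inv a, hM.1.1 a a.2⟩⟩
  let _ : Group M := Group.ofLeftAxioms (fun a b c => Subtype.ext <|
      (hP.assoc_pi [] [(a : L), b] [(c : L)] (hD [a, b, c])).symm.trans
        (hP.pi_cons (hD [a, b, c])).2)
    (fun a => Subtype.ext ((hP.one_cons (hP.singleton_mem a)).2.trans (hP.pi_singleton a)))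
    (fun a => Subtype.ext (hP.pi_inv_self a))
  refine ⟨inferInstance, Subtype.val_injective, hD, fun w => ?_,
    fun _ => rfl⟩
  induction w with
  | nil => rfl
  | cons a w ih =>
    rw [List.map_cons, (hP.pi_cons (hD (a :: w))).2, ih]
    rfl

namespace Models

theorem prodMap {P' : Data L'} {ψ : H → L'} (h : Models P φ) (h' : Models P' ψ) :
    Models (prodData P P') (Prod.map φ ψ) := by
  have e₁ : ∀ w : List (G × H), (w.map (Prod.map φ ψ)).map Prod.fst = (w.map Prod.fst).map φ :=
    fun w => by simp
  have e₂ : ∀ w : List (G × H), (w.map (Prod.map φ ψ)).map Prod.snd = (w.map Prod.snd).map ψ :=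
    fun w => by simp
  refine ⟨h.injective.prodMap h'.injective, fun w => ⟨?_, ?_⟩, fun w => Prod.ext ?_ ?_,
    fun g => Prod.ext (h.inv_map _) (h'.inv_map _)⟩
  · rw [e₁]; exact h.mem_D _
  · rw [e₂]; exact h'.mem_D _
  · change P.pi _ = φ w.prod.1
    rw [e₁, h.pi_map]
    exact congrArg φ (map_list_prod (MonoidHom.fst G H) w).symm
  · change P'.pi _ = ψ w.prod.2
    rw [e₂, h'.pi_map]
    exact congrArg ψ (map_list_prod (MonoidHom.snd G H) w).symm

theorem restrict (h : Models P φ) (K : Subgroup G) :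
    Models P (fun k : K => φ k) := by
  have e : ∀ w : List K, w.map (fun k : K => φ k) = (w.map Subtype.val).map φ := fun w => by simp
  refine ⟨h.injective.comp Subtype.val_injective, fun w => ?_, fun w => ?_,
    fun g => h.inv_map _⟩
  · rw [e]; exact h.mem_D _
  · rw [e, h.pi_map, Subgroup.val_list_prod]

theorem map_one (h : Models P φ) : P.one = φ 1 := h.pi_map []

theorem mem_Dconj (h : Models P φ) (x g : G) : φ x ∈ P.Dconj (φ g) := by
  simpa [Data.Dconj, h.inv_map] using h.mem_D [g⁻¹, x, g]

theorem conj_map (h : Models P φ) (x g : G) : P.conj (φ x) (φ g) = φ (g⁻¹ * x * g) := by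
  simpa [Data.conj, h.inv_map, mul_assoc] using h.pi_map [g⁻¹, x, g]

theorem isSubgroup_image (h : Models P φ) (K : Subgroup G) : P.IsSubgroup (φ '' K) := by
  refine ⟨⟨?_, ?_⟩, ?_⟩
  · rintro _ ⟨k, hk, rfl⟩
    exact ⟨k⁻¹, K.inv_mem hk, (h.inv_map k).symm⟩
  · rintro w ⟨hw, -⟩
    obtain ⟨v, hv, rfl⟩ := exists_map_eq_of_mem_wrd φ K hw
    exact ⟨v.prod, K.list_prod_mem hv, (h.pi_map v).symm⟩
  · intro w hw
    obtain ⟨v, -, rfl⟩ := exists_map_eq_of_mem_wrd φ K hw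
    exact h.mem_D v

theorem exists_subgroup (h : Models P φ) {K : Set L} (hK : P.IsSubgroup K)
    (hKφ : K ⊆ Set.range φ) : ∃ K' : Subgroup G, φ '' K' = K := by
  refine ⟨⟨⟨⟨φ ⁻¹' K, fun {a b} ha hb => ?_⟩, ?_⟩, fun {a} ha => ?_⟩,
    Set.image_preimage_eq_of_subset hKφ⟩
  · have := hK.pi_mem (w := [a, b].map φ) (by simp [Wrd]; exact ⟨ha, hb⟩)
    rwa [h.pi_map, List.prod_pair] at this
  · simpa [h.map_one] using hK.one_mem
  · simpa [h.inv_map] using hK.1.1 _ ha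

theorem pCoreIn_range [Finite G] [Fact p.Prime] (h : Models P φ) :
    P.pCoreIn p (Set.range φ) = φ '' {g | InPCore p g} := by
  ext y
  constructor
  · rintro ⟨K, ⟨hKφ, hK, ⟨n, hn⟩, hconj⟩, hy⟩
    obtain ⟨K', rfl⟩ := h.exists_subgroup hK hKφ
    obtain ⟨k, hk, rfl⟩ := hy
    rw [Set.ncard_image_of_injective _ h.injective] at hn
    refine ⟨k, ⟨K', ⟨fun x hx g => ?_⟩, IsPGroup.of_card hn, hk⟩, rfl⟩
    have := (hconj _ ⟨g⁻¹, rfl⟩ _ ⟨x, hx, rfl⟩).2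
    rw [h.conj_map, h.injective.mem_set_image] at this
    simpa using this
  · rintro ⟨k, ⟨K, hK, hKp, hk⟩, rfl⟩
    refine ⟨φ '' K, ⟨Set.image_subset_range _ _, h.isSubgroup_image K, ?_, ?_⟩, k, hk, rfl⟩
    · obtain ⟨n, hn⟩ := IsPGroup.iff_card.1 hKp
      exact ⟨n, by rw [Set.ncard_image_of_injective _ h.injective]; exact hn⟩
    · rintro _ ⟨g, rfl⟩ _ ⟨x, hx, rfl⟩
      refine ⟨h.mem_Dconj x g, ?_⟩
      rw [h.conj_map]
      exact ⟨_, by simpa using hK.conj_mem x hx g⁻¹, rfl⟩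

theorem isCharPSubgroup_range_iff [Finite G] [Fact p.Prime] (h : Models P φ) :
    P.IsCharPSubgroup p (Set.range φ) ↔ IsGroupCharP G p := by
  rw [Data.IsCharPSubgroup, h.pCoreIn_range]
  constructor
  · intro hc g hg
    refine h.injective.mem_set_image.1 (hc ⟨⟨g, rfl⟩, ?_⟩)
    rintro _ ⟨x, hx, rfl⟩
    exact ⟨h.mem_Dconj x g, by rw [h.conj_map, hg x hx]⟩
  · rintro hc _ ⟨⟨g, rfl⟩, hg⟩
    refine ⟨g, hc g fun x hx => h.injective ?_, rfl⟩
    rw [← h.conj_map]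
    exact (hg _ ⟨x, hx, rfl⟩).2

theorem normalizer_image (h : Models P φ) (K : Subgroup G)
    (hK : P.normalizer (φ '' K) ⊆ Set.range φ) :
    P.normalizer (φ '' K) = Set.range fun g : Subgroup.normalizer (K : Set G) => φ g := by
  ext y
  constructor
  · intro hy
    obtain ⟨g, rfl⟩ := hK hy
    refine ⟨⟨g, Subgroup.mem_normalizer_iff''.2 fun x => ⟨fun hx => ?_, fun hx => ?_⟩⟩, rfl⟩
    · have := conj_mem_of_mem_normalizer hy ⟨x, hx, rfl⟩
      rwa [h.conj_map, h.injective.mem_set_image] at this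
    · obtain ⟨_, ⟨z, hz, rfl⟩, hzx⟩ := hy.2.superset ⟨_, hx, rfl⟩
      have hzx' := h.injective ((h.conj_map z g).symm.trans hzx)
      rwa [← mul_left_cancel (mul_right_cancel hzx')]
  · rintro ⟨⟨g, hg⟩, rfl⟩
    rw [Subgroup.mem_normalizer_iff''] at hg
    refine mem_normalizer_of ?_ ?_
    · rintro _ ⟨x, hx, rfl⟩
      refine ⟨h.mem_Dconj x g, ?_⟩
      rw [h.conj_map]
      exact ⟨_, (hg x).1 hx, rfl⟩
    · rintro _ ⟨x, hx, rfl⟩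
      have e : g⁻¹ * (g * x * g⁻¹) * g = x := by group
      refine ⟨_, ⟨g * x * g⁻¹, (hg _).2 (by rwa [e]), rfl⟩, ?_⟩
      rw [h.conj_map, e]

/-- Elements of a `p`-subgroup of the partial group have `p`-power order in `G`. -/
theorem exists_pow_eq_one (hP : IsPartialGroup P) (h : Models P φ) {S : Set L}
    (hS : P.IsPSubgroup p S) {g : G} (hg : φ g ∈ S) : ∃ n : ℕ, g ^ p ^ n = 1 := by
  obtain ⟨hS, n, hn⟩ := hS
  obtain ⟨_, hm⟩ := hS.exists_models hP
  refine ⟨n, h.injective ?_⟩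
  have e : (⟨φ g, hg⟩ : S) ^ p ^ n = 1 := by
    rw [← hn]
    exact pow_card_eq_one'
  have h₁ := hm.pi_map (List.replicate (p ^ n) ⟨φ g, hg⟩)
  have h₂ := h.pi_map (List.replicate (p ^ n) g)
  rw [List.prod_replicate, List.map_replicate] at h₁ h₂
  rw [← h₂, h₁, e, ← h.map_one, hm.map_one]

end Models

end Models

section Products

variable {P₁ : Data L₁} {P₂ : Data L₂} {Q : Set (L₁ × L₂)}

theorem isSubgroup_fst_image (hQ : (prodData P₁ P₂).IsSubgroup Q) :
    P₁.IsSubgroup (Prod.fst '' Q) := by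
  have key : ∀ w ∈ Wrd (Prod.fst '' Q), ∃ v ∈ Wrd Q, v.map Prod.fst = w :=
    fun w hw => exists_map_eq_of_mem_wrd Prod.fst Q hw
  refine ⟨⟨?_, ?_⟩, ?_⟩
  · rintro _ ⟨q, hq, rfl⟩
    exact ⟨_, hQ.1.1 q hq, rfl⟩
  · rintro w ⟨hw, -⟩
    obtain ⟨v, hv, rfl⟩ := key w hw
    exact ⟨_, hQ.pi_mem hv, rfl⟩
  · intro w hw
    obtain ⟨v, hv, rfl⟩ := key w hw
    exact (hQ.2 hv).1

theorem isSubgroup_snd_image (hQ : (prodData P₁ P₂).IsSubgroup Q) :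
    P₂.IsSubgroup (Prod.snd '' Q) := by
  have key : ∀ w ∈ Wrd (Prod.snd '' Q), ∃ v ∈ Wrd Q, v.map Prod.snd = w :=
    fun w hw => exists_map_eq_of_mem_wrd Prod.snd Q hw
  refine ⟨⟨?_, ?_⟩, ?_⟩
  · rintro _ ⟨q, hq, rfl⟩
    exact ⟨_, hQ.1.1 q hq, rfl⟩
  · rintro w ⟨hw, -⟩
    obtain ⟨v, hv, rfl⟩ := key w hw
    exact ⟨_, hQ.pi_mem hv, rfl⟩
  · intro w hw
    obtain ⟨v, hv, rfl⟩ := key w hw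
    exact (hQ.2 hv).2

theorem Data.IsSubgroup.prod {K₁ : Set L₁} {K₂ : Set L₂} (h₁ : P₁.IsSubgroup K₁)
    (h₂ : P₂.IsSubgroup K₂) : (prodData P₁ P₂).IsSubgroup (K₁ ×ˢ K₂) := by
  have key : ∀ w ∈ Wrd (K₁ ×ˢ K₂), w.map Prod.fst ∈ Wrd K₁ ∧ w.map Prod.snd ∈ Wrd K₂ := by
    refine fun w hw => ⟨fun x hx => ?_, fun x hx => ?_⟩ <;>
      obtain ⟨y, hy, rfl⟩ := List.mem_map.1 hx
    exacts [(hw y hy).1, (hw y hy).2]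
  exact ⟨⟨fun f hf => ⟨h₁.1.1 _ hf.1, h₂.1.1 _ hf.2⟩,
    fun w hw => ⟨h₁.pi_mem (key w hw.1).1, h₂.pi_mem (key w hw.1).2⟩⟩,
    fun w hw => ⟨h₁.2 (key w hw).1, h₂.2 (key w hw).2⟩⟩

theorem normalizer_prodData_subset :
    (prodData P₁ P₂).normalizer Q ⊆
      (P₁.normalizer (Prod.fst '' Q)) ×ˢ (P₂.normalizer (Prod.snd '' Q)) := by
  intro g hg
  refine ⟨mem_normalizer_of ?_ ?_, mem_normalizer_of ?_ ?_⟩ <;> rintro _ ⟨q, hq, rfl⟩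
  · exact ⟨(hg.1 hq).1, _, conj_mem_of_mem_normalizer hg hq, rfl⟩
  · obtain ⟨x, hx, rfl⟩ := hg.2.superset hq
    exact ⟨_, ⟨x, hx, rfl⟩, rfl⟩
  · exact ⟨(hg.1 hq).2, _, conj_mem_of_mem_normalizer hg hq, rfl⟩
  · obtain ⟨x, hx, rfl⟩ := hg.2.superset hq
    exact ⟨_, ⟨x, hx, rfl⟩, rfl⟩

theorem normalizer_prod_subset (K₁ : Set L₁) (K₂ : Set L₂) :
    (P₁.normalizer K₁) ×ˢ (P₂.normalizer K₂) ⊆ (prodData P₁ P₂).normalizer (K₁ ×ˢ K₂) := by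
  rintro ⟨g₁, g₂⟩ ⟨h₁, h₂⟩
  refine mem_normalizer_of ?_ ?_
  · rintro ⟨x₁, x₂⟩ ⟨hx₁, hx₂⟩
    exact ⟨⟨h₁.1 hx₁, h₂.1 hx₂⟩,
      conj_mem_of_mem_normalizer h₁ hx₁, conj_mem_of_mem_normalizer h₂ hx₂⟩
  · rintro ⟨y₁, y₂⟩ ⟨hy₁, hy₂⟩
    obtain ⟨x₁, hx₁, rfl⟩ := h₁.2.superset hy₁
    obtain ⟨x₂, hx₂, rfl⟩ := h₂.2.superset hy₂
    exact ⟨(x₁, x₂), ⟨hx₁, hx₂⟩, rfl⟩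

end Products

/-- Lemma 5.5: let `(L,Δ,S) = (L₁ × L₂, Δ₁*Δ₂, S₁ × S₂)` be the external direct
product of localities, let `P ≤ S` be a subgroup and `P_i = Pπ_i`.  Then:
(a) `N_L(P) ⊆ N_{L₁}(P₁) × N_{L₂}(P₂)`; (b) equality holds if `P = P₁ × P₂`;
(c) if `P ∈ Δ` then `P_i ∈ Δ_i` (so `P₁ × P₂ ∈ Δ`), and `N_L(P)` is of
characteristic `p` provided `N_{L₁}(P₁)` and `N_{L₂}(P₂)` are; (d) if
`P = P₁ × P₂ ∈ Δ` then `N_L(P)` is of characteristic `p` iff both `N_{L_i}(P_i)`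
are. -/
theorem prod_normalizers (p : ℕ) (hp : p.Prime)
    (P₁ : Data L₁) (Δ₁ : Set (Set L₁)) (S₁ : Set L₁)
    (P₂ : Data L₂) (Δ₂ : Set (Set L₂)) (S₂ : Set L₂)
    (h₁ : IsLocality p P₁ Δ₁ S₁) (h₂ : IsLocality p P₂ Δ₂ S₂)
    (Q : Set (L₁ × L₂)) (hQ : (prodData P₁ P₂).IsSubgroup Q) (hQS : Q ⊆ S₁ ×ˢ S₂) :
    ((prodData P₁ P₂).normalizer Q ⊆
        (P₁.normalizer (Prod.fst '' Q)) ×ˢ (P₂.normalizer (Prod.snd '' Q))) ∧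
    (Q = (Prod.fst '' Q) ×ˢ (Prod.snd '' Q) →
      (prodData P₁ P₂).normalizer Q =
        (P₁.normalizer (Prod.fst '' Q)) ×ˢ (P₂.normalizer (Prod.snd '' Q))) ∧
    (Q ∈ deltaStar P₁ P₂ Δ₁ Δ₂ S₁ S₂ →
      (Prod.fst '' Q ∈ Δ₁ ∧ Prod.snd '' Q ∈ Δ₂ ∧
        (Prod.fst '' Q) ×ˢ (Prod.snd '' Q) ∈ deltaStar P₁ P₂ Δ₁ Δ₂ S₁ S₂) ∧
      (P₁.IsCharPSubgroup p (P₁.normalizer (Prod.fst '' Q)) →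
        P₂.IsCharPSubgroup p (P₂.normalizer (Prod.snd '' Q)) →
        (prodData P₁ P₂).IsCharPSubgroup p ((prodData P₁ P₂).normalizer Q))) ∧
    (Q = (Prod.fst '' Q) ×ˢ (Prod.snd '' Q) → Q ∈ deltaStar P₁ P₂ Δ₁ Δ₂ S₁ S₂ →
      ((prodData P₁ P₂).IsCharPSubgroup p ((prodData P₁ P₂).normalizer Q) ↔
        P₁.IsCharPSubgroup p (P₁.normalizer (Prod.fst '' Q)) ∧
        P₂.IsCharPSubgroup p (P₂.normalizer (Prod.snd '' Q)))) := by
  have := Fact.mk hp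
  have hb : Q = (Prod.fst '' Q) ×ˢ (Prod.snd '' Q) → (prodData P₁ P₂).normalizer Q =
      (P₁.normalizer (Prod.fst '' Q)) ×ˢ (P₂.normalizer (Prod.snd '' Q)) := fun h =>
    Set.Subset.antisymm normalizer_prodData_subset
      ((normalizer_prod_subset _ _).trans_eq (congrArg _ h.symm))
  have hQ₁ := isSubgroup_fst_image hQ
  have hQ₂ := isSubgroup_snd_image hQ
  have hΔ : Q ∈ deltaStar P₁ P₂ Δ₁ Δ₂ S₁ S₂ → Prod.fst '' Q ∈ Δ₁ ∧ Prod.snd '' Q ∈ Δ₂ := by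
    rintro ⟨-, -, R₁, hR₁, R₂, hR₂, hR⟩
    have hone₁ := (h₁.delta_subgroups R₁ hR₁).1.one_mem
    have hone₂ := (h₂.delta_subgroups R₂ hR₂).1.one_mem
    exact ⟨h₁.mem_of_subset hR₁ (fun x hx => ⟨(x, P₂.one), hR ⟨hx, hone₂⟩, rfl⟩) hQ₁
        (Set.image_subset_iff.2 fun q hq => (hQS hq).1),
      h₂.mem_of_subset hR₂ (fun x hx => ⟨(P₁.one, x), hR ⟨hone₁, hx⟩, rfl⟩) hQ₂
        (Set.image_subset_iff.2 fun q hq => (hQS hq).2)⟩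
  refine ⟨normalizer_prodData_subset, hb, fun hQΔ => ?_, fun hQprod hQΔ => ?_⟩ <;>
    obtain ⟨hQΔ₁, hQΔ₂⟩ := hΔ hQΔ <;>
    have := h₁.finite <;> have := h₂.finite <;>
    obtain ⟨_, m₁⟩ := (h₁.isSubgroup_normalizer hQΔ₁).exists_models h₁.isPartialGroup <;>
    obtain ⟨_, m₂⟩ := (h₂.isSubgroup_normalizer hQΔ₂).exists_models h₂.isPartialGroup <;>
    have c₁ := m₁.isCharPSubgroup_range_iff (p := p) <;>
    have c₂ := m₂.isCharPSubgroup_range_iff (p := p) <;>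
    rw [Subtype.range_val] at c₁ c₂ <;>
    have m := m₁.prodMap m₂ <;>
    have hrange := Set.range_prodMap (m₁ := (Subtype.val : P₁.normalizer (Prod.fst '' Q) → L₁))
      (m₂ := (Subtype.val : P₂.normalizer (Prod.snd '' Q) → L₂)) <;>
    rw [Subtype.range_val, Subtype.range_val] at hrange
  · refine ⟨⟨hQΔ₁, hQΔ₂, hQ₁.prod hQ₂, ?_, _, hQΔ₁, _, hQΔ₂, subset_rfl⟩, fun k₁ k₂ => ?_⟩
    · exact Set.prod_mono (h₁.delta_subgroups _ hQΔ₁).2 (h₂.delta_subgroups _ hQΔ₂).2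
    have hQr : Q ⊆ Set.range (Prod.map (Subtype.val : P₁.normalizer (Prod.fst '' Q) → L₁)
        (Subtype.val : P₂.normalizer (Prod.snd '' Q) → L₂)) := hrange ▸ fun q hq =>
      ⟨hQ₁.subset_normalizer h₁.isPartialGroup ⟨q, hq, rfl⟩,
        hQ₂.subset_normalizer h₂.isPartialGroup ⟨q, hq, rfl⟩⟩
    obtain ⟨K, hK⟩ := m.exists_subgroup hQ hQr
    have hKp : IsPGroup p K := by
      rintro ⟨⟨a, b⟩, hab⟩
      have habS := hQS (hK.subset ⟨_, hab, rfl⟩)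
      obtain ⟨n₁, hn₁⟩ := m₁.exists_pow_eq_one h₁.isPartialGroup h₁.pSubgroup habS.1
      obtain ⟨n₂, hn₂⟩ := m₂.exists_pow_eq_one h₂.isPartialGroup h₂.pSubgroup habS.2
      refine ⟨n₁ + n₂, Subtype.ext (Prod.ext ?_ ?_)⟩
      · change a ^ p ^ (n₁ + n₂) = 1
        rw [pow_add, pow_mul, hn₁, one_pow]
      · change b ^ p ^ (n₁ + n₂) = 1
        rw [add_comm, pow_add, pow_mul, hn₂, one_pow]
    have hN := m.normalizer_image K <| by
      rw [hK, hrange]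
      exact normalizer_prodData_subset
    rw [hK] at hN
    rw [hN, (m.restrict _).isCharPSubgroup_range_iff]
    exact (isGroupCharP_prod_iff.2 ⟨c₁.1 k₁, c₂.1 k₂⟩).normalizer K hKp
  · rw [hb hQprod, c₁, c₂, ← isGroupCharP_prod_iff, ← m.isCharPSubgroup_range_iff, hrange]

end PartialGroups
end

section
/- For i = 1,2 let (L_i,Δ_i,S_i) be a locality. The external direct product locality (L_1 × L_2, Δ_1*Δ_2, S_1 × S_2) is of objective characteristic p if and only if (L_i,Δ_i,S_i) is of objective characteristic p for each i = 1,2. -/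
/-!
Background definitions for partial groups and localities in the sense of Chermak.

A *partial group* is given by `Data`: a domain `D` of words, a (total, but only
meaningful on `D`) product `pi : List L → L`, and an inversion map, subject to the
axioms collected in `IsPartialGroup`.
-/

namespace PartialGroups

variable {L L' L₁ L₂ L₁' L₂' : Type*}

section Groups

/-- `O_p(G)`: the largest normal `p`-subgroup of a group `G`. -/
def pCore (p : ℕ) (G : Type*) [Group G] : Subgroup G where
  carrier := {g | ∃ H : Subgroup G, H.Normal ∧ IsPGroup p H ∧ g ∈ H}
  one_mem' := ⟨⊥, inferInstance, IsPGroup.of_bot, one_mem _⟩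
  mul_mem' := by
    rintro a b ⟨H, hH, hHp, ha⟩ ⟨K, hK, hKp, hb⟩
    exact ⟨H ⊔ K, inferInstance, hHp.to_sup_of_normal_right hKp,
      mul_mem (Subgroup.mem_sup_left ha) (Subgroup.mem_sup_right hb)⟩
  inv_mem' := by
    rintro a ⟨H, hH, hHp, ha⟩
    exact ⟨H, hH, hHp, inv_mem ha⟩

/-- A group `G` is of characteristic `p` if `C_G(O_p(G)) ≤ O_p(G)`. -/
def IsCharPGroup (p : ℕ) (G : Type*) [Group G] : Prop :=
  Subgroup.centralizer (pCore p G : Set G) ≤ pCore p G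

variable {p : ℕ} {G G₁ G₂ : Type*} [Group G] [Group G₁] [Group G₂]

theorem mem_pCore {g : G} :
    g ∈ pCore p G ↔ ∃ H : Subgroup G, H.Normal ∧ IsPGroup p H ∧ g ∈ H := Iff.rfl

theorem le_pCore {H : Subgroup G} (hH : H.Normal) (hp : IsPGroup p H) : H ≤ pCore p G :=
  fun _ hg => ⟨H, hH, hp, hg⟩

theorem isPGroup_pCore : IsPGroup p (pCore p G) := by
  rintro ⟨g, H, -, hH, hg⟩
  obtain ⟨k, hk⟩ := hH ⟨g, hg⟩
  exact ⟨k, by simpa [Subtype.ext_iff] using hk⟩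

instance pCore_normal : (pCore p G).Normal :=
  ⟨fun _ ⟨H, hH, hp, hn⟩ g => ⟨H, hH, hp, hH.conj_mem _ hn g⟩⟩

theorem mem_pCore_prod {x : G₁ × G₂} :
    x ∈ pCore p (G₁ × G₂) ↔ x.1 ∈ pCore p G₁ ∧ x.2 ∈ pCore p G₂ := by
  constructor
  · rintro ⟨H, hH, hp, hx⟩
    exact ⟨⟨H.map (MonoidHom.fst G₁ G₂), hH.map _ Prod.fst_surjective, hp.map _, x, hx, rfl⟩,
      ⟨H.map (MonoidHom.snd G₁ G₂), hH.map _ Prod.snd_surjective, hp.map _, x, hx, rfl⟩⟩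
  · rintro ⟨⟨H, hH, hHp, hx⟩, ⟨K, hK, hKp, hy⟩⟩
    refine ⟨H.prod K, inferInstance, ?_, hx, hy⟩
    rintro ⟨⟨a, b⟩, hab⟩
    obtain ⟨ha, hb⟩ := Subgroup.mem_prod.1 hab
    obtain ⟨k, hk⟩ := hHp ⟨a, ha⟩
    obtain ⟨l, hl⟩ := hKp ⟨b, hb⟩
    simp only [Subtype.ext_iff, SubmonoidClass.mk_pow, OneMemClass.coe_one] at hk hl
    refine ⟨k + l, Subtype.ext (Prod.ext ?_ ?_)⟩
    · change a ^ p ^ (k + l) = 1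
      rw [pow_add, pow_mul, hk, one_pow]
    · change b ^ p ^ (k + l) = 1
      rw [add_comm, pow_add, pow_mul, hl, one_pow]

theorem isCharPGroup_prod :
    IsCharPGroup p (G₁ × G₂) ↔ IsCharPGroup p G₁ ∧ IsCharPGroup p G₂ := by
  constructor
  · refine fun h => ⟨fun x hx => ?_, fun x hx => ?_⟩
    · refine (mem_pCore_prod.1 (h (x := (x, 1)) ?_)).1
      rw [Subgroup.mem_centralizer_iff] at hx ⊢
      intro y hy
      simpa [Prod.ext_iff] using hx _ (mem_pCore_prod.1 hy).1
    · refine (mem_pCore_prod.1 (h (x := (1, x)) ?_)).2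
      rw [Subgroup.mem_centralizer_iff] at hx ⊢
      intro y hy
      simpa [Prod.ext_iff] using hx _ (mem_pCore_prod.1 hy).2
  · rintro ⟨h₁, h₂⟩ x hx
    rw [Subgroup.mem_centralizer_iff] at hx
    refine mem_pCore_prod.2 ⟨h₁ ?_, h₂ ?_⟩
    · rw [Subgroup.mem_centralizer_iff]
      intro y hy
      exact congrArg Prod.fst (hx (y, 1) (mem_pCore_prod.2 ⟨hy, one_mem _⟩))
    · rw [Subgroup.mem_centralizer_iff]
      intro y hy
      exact congrArg Prod.snd (hx (1, y) (mem_pCore_prod.2 ⟨one_mem _, hy⟩))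

theorem eq_one_of_pow_eq_one_of_coprime {g : G} {a b : ℕ} (hab : a.Coprime b)
    (ha : g ^ a = 1) (hb : g ^ b = 1) : g = 1 := by
  have h := Nat.eq_one_of_dvd_coprimes hab (orderOf_dvd_of_pow_eq_one ha)
    (orderOf_dvd_of_pow_eq_one hb)
  exact orderOf_eq_one_iff.1 h

/-- An element of order prime to `p` that centralizes `N_O(H)`, where `O` is a finite normal
`p`-subgroup and `H ≤ O`, centralizes `O`. -/
theorem commute_of_commute_normalizer [Fact p.Prime] [Finite G] {O H : Subgroup G}
    (hO : O.Normal) (hOp : IsPGroup p O) (hH : H ≤ O) {y : G} {m : ℕ} (hm : p.Coprime m)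
    (hym : y ^ m = 1)
    (hy : ∀ n ∈ O, n ∈ Subgroup.normalizer (H : Set G) → Commute n y) :
    ∀ n ∈ O, Commute n y := by
  let V : Subgroup O := (Subgroup.centralizer {y}).subgroupOf O
  have memV (n : O) : n ∈ V ↔ Commute (n : G) y := by
    simp only [V, Subgroup.mem_subgroupOf, Subgroup.mem_centralizer_singleton_iff]
    rfl
  have : Group.IsNilpotent O := hOp.isNilpotent
  have hnc := normalizerCondition_iff_only_full_group_self_normalizing.1
    (Group.normalizerCondition_of_isNilpotent (G := O))
  have hV : Subgroup.normalizer (V : Set O) ≤ V := by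
    intro n hn
    rw [memV]
    set c : G := y * n * y⁻¹ * (n : G)⁻¹ with hc
    have hcO : c ∈ O := mul_mem (hO.conj_mem _ n.2 y) (inv_mem n.2)
    have hcV : ∀ v : O, v ∈ V → c * v * c⁻¹ = v := by
      intro v hv
      have h1 := (Subgroup.mem_normalizer_iff''.1 hn v).1 hv
      rw [memV] at hv h1
      have h2 : y * ((n : G)⁻¹ * v * n) * y⁻¹ = (n : G)⁻¹ * v * n := by
        rw [mul_inv_eq_iff_eq_mul]; exact h1.symm.eq
      have h3 : c * v * c⁻¹ = y * n * y⁻¹ * (y * ((n : G)⁻¹ * v * n) * y⁻¹) *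
          (y * (n : G)⁻¹ * y⁻¹) := by
        rw [h2, hc]; group
      rw [h3]
      have h4 : y * v * y⁻¹ = (v : G) := by
        rw [mul_inv_eq_iff_eq_mul]; exact hv.symm.eq
      exact Eq.trans (by group) h4
    have hcH : ∀ h ∈ H, c * h * c⁻¹ = h := fun h hh =>
      hcV ⟨h, hH hh⟩ ((memV _).2 (hy _ (hH hh) (Subgroup.le_normalizer hh)))
    have hcN : c ∈ Subgroup.normalizer (H : Set G) := by
      rw [Subgroup.mem_normalizer_iff]
      refine fun h => ⟨fun hh => by rwa [hcH h hh], fun hh => ?_⟩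
      have h1 := hcH _ hh
      have h2 : c * h * c⁻¹ = h := mul_left_cancel (mul_right_cancel h1)
      rwa [h2] at hh
    have hcy : Commute c y := hy c hcO hcN
    have hyn : y * n = c * n * y := by rw [hc]; group
    have key : ∀ k : ℕ, y ^ k * n = c ^ k * n * y ^ k := by
      intro k
      induction k with
      | zero => simp
      | succ k ih =>
        calc y ^ (k + 1) * n = y * (y ^ k * n) := by rw [pow_succ']; group
          _ = (y * c ^ k) * n * y ^ k := by rw [ih]; group
          _ = c ^ k * (y * n) * y ^ k := by rw [(hcy.pow_left k).symm.eq]; group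
          _ = c ^ (k + 1) * n * y ^ (k + 1) := by
            rw [hyn, pow_succ, pow_succ']; simp only [mul_assoc]
    have hcm : c ^ m = 1 := by
      have := key m
      rw [hym, one_mul, mul_one] at this
      exact right_eq_mul.1 this
    obtain ⟨k, hk⟩ := hOp ⟨c, hcO⟩
    have hk' : c ^ p ^ k = 1 := by simpa [Subtype.ext_iff] using hk
    have hc1 : c = 1 := eq_one_of_pow_eq_one_of_coprime (hm.pow_left k) hk' hcm
    rw [hc1, one_mul] at hyn
    exact hyn.symm
  have hVtop : V = ⊤ := hnc V (le_antisymm hV Subgroup.le_normalizer)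
  intro n hn
  exact (memV ⟨n, hn⟩).1 (hVtop ▸ Subgroup.mem_top _)

/-- If `G` is of characteristic `p`, then so is the normalizer of any subgroup of `O_p(G)`. -/
theorem IsCharPGroup.normalizer [Fact p.Prime] [Finite G] (hG : IsCharPGroup p G)
    {H : Subgroup G} (hH : H ≤ pCore p G) :
    IsCharPGroup p (Subgroup.normalizer (H : Set G)) := by
  refine le_pCore inferInstance ?_
  rintro ⟨g, hg⟩
  obtain ⟨k, m, hpm, hkm⟩ := Nat.exists_eq_pow_mul_and_not_dvd
    (orderOf_pos (g : G)).ne' p (Fact.out : p.Prime).ne_one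
  refine ⟨k, ?_⟩
  have hm : p.Coprime m := ((Fact.out : p.Prime).coprime_iff_not_dvd).2 hpm
  have hym : ((g : G) ^ p ^ k) ^ m = 1 := by rw [← pow_mul, ← hkm, pow_orderOf_eq_one]
  set O := pCore p G
  have hOn : IsPGroup p (O.subgroupOf (Subgroup.normalizer (H : Set G))) :=
    isPGroup_pCore.comap_of_injective _ (Subgroup.subtype_injective _)
  have hy : ∀ n ∈ O, n ∈ Subgroup.normalizer (H : Set G) → Commute n ((g : G) ^ p ^ k) := by
    intro n hn hnN
    refine Commute.pow_right ?_ _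
    have := Subgroup.mem_centralizer_iff.1 hg ⟨n, hnN⟩ (le_pCore inferInstance hOn hn)
    exact congrArg Subtype.val this
  have hcent := commute_of_commute_normalizer inferInstance isPGroup_pCore hH hm hym hy
  have hyO : (g : G) ^ p ^ k ∈ O := hG (Subgroup.mem_centralizer_iff.2 fun n hn => hcent n hn)
  obtain ⟨l, hl⟩ := isPGroup_pCore ⟨_, hyO⟩
  have hl' : ((g : G) ^ p ^ k) ^ p ^ l = 1 := by simpa [Subtype.ext_iff] using hl
  have := eq_one_of_pow_eq_one_of_coprime (hm.pow_left l) hl' hym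
  simpa [Subtype.ext_iff] using this

end Groups

namespace IsPartialGroup

variable {P : Data L}

theorem nil_mem [hL : Nonempty L] (hP : IsPartialGroup P) : [] ∈ P.D :=
  hL.elim fun f => hP.append_left [] [f] (hP.singleton_mem f)

theorem wInv_wInv_s17 (hP : IsPartialGroup P) (w : List L) : P.wInv (P.wInv w) = w := by
  have : P.inv ∘ P.inv = id := funext hP.inv_inv
  simp [Data.wInv, List.map_reverse, this]

theorem insert_one (hP : IsPartialGroup P) {u v : List L} (h : u ++ v ∈ P.D) :
    u ++ [P.one] ++ v ∈ P.D ∧ P.pi (u ++ [P.one] ++ v) = P.pi (u ++ v) := by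
  have h' : u ++ [] ++ v ∈ P.D := by simpa using h
  refine ⟨hP.assoc_mem u [] v h', ?_⟩
  have := hP.assoc_pi u [] v h'
  rw [List.append_nil] at this
  exact this.symm

theorem one_cons_s17 (hP : IsPartialGroup P) {v : List L} (h : v ∈ P.D) :
    P.one :: v ∈ P.D ∧ P.pi (P.one :: v) = P.pi v :=
  hP.insert_one (u := []) h

theorem concat_one (hP : IsPartialGroup P) {u : List L} (h : u ∈ P.D) :
    u ++ [P.one] ∈ P.D ∧ P.pi (u ++ [P.one]) = P.pi u := by
  simpa using hP.insert_one (u := u) (v := []) (by simpa using h)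

theorem mem_wInv (hP : IsPartialGroup P) {w : List L} (h : w ∈ P.D) : P.wInv w ∈ P.D :=
  hP.append_left _ _ (hP.wInv_mem w h)

theorem append_wInv_mem_s17 (hP : IsPartialGroup P) {w : List L} (h : w ∈ P.D) :
    w ++ P.wInv w ∈ P.D := by
  simpa only [hP.wInv_wInv_s17] using hP.wInv_mem _ (hP.mem_wInv h)

theorem concat_inv_mem (hP : IsPartialGroup P) {u : List L} {f : L} (h : u ++ [f] ∈ P.D) :
    u ++ [f, P.inv f] ∈ P.D :=
  hP.append_left _ (P.wInv u) (by simpa [Data.wInv] using hP.append_wInv_mem_s17 h)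

theorem inv_cons_mem (hP : IsPartialGroup P) {u : List L} {f : L} (h : f :: u ∈ P.D) :
    P.inv f :: f :: u ∈ P.D :=
  hP.append_right (P.wInv u) _ (by simpa [Data.wInv] using hP.wInv_mem _ h)

theorem inv_pair (hP : IsPartialGroup P) (f : L) :
    [P.inv f, f] ∈ P.D ∧ P.pi [P.inv f, f] = P.one :=
  ⟨hP.wInv_mem _ (hP.singleton_mem f), hP.wInv_pi _ (hP.singleton_mem f)⟩

theorem pair_inv (hP : IsPartialGroup P) (f : L) :
    [f, P.inv f] ∈ P.D ∧ P.pi [f, P.inv f] = P.one := by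
  simpa only [hP.inv_inv] using hP.inv_pair (P.inv f)

theorem eq_inv_of_pi_eq_one (hP : IsPartialGroup P) {a f : L} (h : [a, f] ∈ P.D)
    (h1 : P.pi [a, f] = P.one) : a = P.inv f := by
  have hm : [a, f, P.inv f] ∈ P.D := hP.concat_inv_mem (u := [a]) h
  have e₁ : P.pi [a, f, P.inv f] = P.pi [P.pi [a, f], P.inv f] :=
    hP.assoc_pi [] [a, f] [P.inv f] hm
  have e₂ : P.pi [a, f, P.inv f] = P.pi [a, P.pi [f, P.inv f]] :=
    hP.assoc_pi [a] [f, P.inv f] [] hm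
  rw [h1, (hP.one_cons_s17 (hP.singleton_mem _)).2, hP.pi_singleton] at e₁
  rw [(hP.pair_inv f).2] at e₂
  have e₃ : P.pi [a, P.one] = a :=
    (hP.concat_one (u := [a]) (hP.singleton_mem a)).2.trans (hP.pi_singleton a)
  exact (e₂.trans e₃).symm.trans e₁

theorem inv_pi (hP : IsPartialGroup P) {w : List L} (h : w ∈ P.D) :
    P.inv (P.pi w) = P.pi (P.wInv w) := by
  have h0 := hP.wInv_mem w h
  have h1 : [P.pi (P.wInv w)] ++ w ∈ P.D := hP.assoc_mem [] (P.wInv w) w h0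
  have e1 : P.pi (P.wInv w ++ w) = P.pi ([P.pi (P.wInv w)] ++ w) :=
    hP.assoc_pi [] (P.wInv w) w h0
  have h1' : [P.pi (P.wInv w)] ++ w ++ [] ∈ P.D := by simpa using h1
  have h2 : [P.pi (P.wInv w), P.pi w] ∈ P.D := hP.assoc_mem _ w [] h1'
  have e2 := hP.assoc_pi _ w [] h1'
  rw [List.append_nil, List.append_nil] at e2
  exact (hP.eq_inv_of_pi_eq_one h2 (e2.symm.trans (e1.symm.trans (hP.wInv_pi w h)))).symm

theorem inv_one_s17 [Nonempty L] (hP : IsPartialGroup P) : P.inv P.one = P.one :=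
  hP.inv_pi hP.nil_mem

theorem conj_one_s17 [Nonempty L] (hP : IsPartialGroup P) (x : L) :
    x ∈ P.Dconj P.one ∧ P.conj x P.one = x := by
  have h1 := hP.one_cons_s17 (hP.singleton_mem x)
  have h2 := hP.concat_one (u := [P.one, x]) h1.1
  unfold Data.Dconj Data.conj
  rw [Set.mem_ofPred_eq, hP.inv_one_s17]
  exact ⟨h2.1, h2.2.trans (h1.2.trans (hP.pi_singleton x))⟩

theorem conj_inv_s17 (hP : IsPartialGroup P) {x g : L} (h : x ∈ P.Dconj g) :
    P.conj x g ∈ P.Dconj (P.inv g) ∧ P.conj (P.conj x g) (P.inv g) = x := by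
  have h1 : [P.inv g, x, g, P.inv g] ∈ P.D := hP.concat_inv_mem (u := [P.inv g, x]) h
  have h2 : [P.inv (P.inv g), P.inv g, x, g, P.inv g] ∈ P.D := hP.inv_cons_mem h1
  unfold Data.conj
  refine ⟨hP.assoc_mem [P.inv (P.inv g)] [P.inv g, x, g] [P.inv g] h2, ?_⟩
  have e1 := hP.assoc_pi [P.inv (P.inv g)] [P.inv g, x, g] [P.inv g] h2
  have e2 := hP.assoc_pi [] [P.inv (P.inv g), P.inv g] [x, g, P.inv g] h2
  have h3 : [x, g, P.inv g] ∈ P.D := hP.append_right [P.inv (P.inv g), P.inv g] _ h2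
  have e3 := hP.assoc_pi [x] [g, P.inv g] [] h3
  rw [(hP.inv_pair (P.inv g)).2] at e2
  rw [(hP.pair_inv g).2] at e3
  refine (e1.symm.trans (e2.trans ((hP.one_cons_s17 h3).2.trans (e3.trans ?_))))
  exact (hP.concat_one (u := [x]) (hP.singleton_mem x)).2.trans (hP.pi_singleton x)

theorem conj_pi (hP : IsPartialGroup P) {w : List L} {x : L}
    (h : P.wInv w ++ [x] ++ w ∈ P.D) :
    x ∈ P.Dconj (P.pi w) ∧ P.conj x (P.pi w) = P.pi (P.wInv w ++ [x] ++ w) := by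
  have hw : w ∈ P.D := hP.append_right _ _ h
  have h0 : P.wInv w ++ [x] ++ w ++ [] ∈ P.D := by simpa using h
  have h1 : [] ++ P.wInv w ++ [x, P.pi w] ∈ P.D := by
    simpa using hP.assoc_mem _ w [] h0
  have e1 := hP.assoc_pi _ w [] h0
  have h2 := hP.assoc_mem [] _ _ h1
  have e2 := hP.assoc_pi [] _ _ h1
  unfold Data.Dconj Data.conj
  rw [Set.mem_ofPred_eq, hP.inv_pi hw]
  refine ⟨h2, ?_⟩
  simp only [List.append_nil, List.nil_append, List.append_assoc, List.cons_append] at e1 e2 ⊢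
  rw [e1, e2]

theorem mem_normalizer_iff (hP : IsPartialGroup P) {Q : Set L} {g : L} :
    g ∈ P.normalizer Q ↔ (∀ x ∈ Q, x ∈ P.Dconj g ∧ P.conj x g ∈ Q) ∧
      ∀ x ∈ Q, x ∈ P.Dconj (P.inv g) ∧ P.conj x (P.inv g) ∈ Q := by
  constructor
  · rintro ⟨hD, hQ⟩
    refine ⟨fun x hx => ⟨hD hx, hQ ▸ ⟨x, hx, rfl⟩⟩, fun x hx => ?_⟩
    rw [← hQ] at hx
    obtain ⟨y, hy, rfl⟩ := hx
    have := hP.conj_inv_s17 (hD hy)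
    exact ⟨this.1, this.2.symm ▸ hy⟩
  · rintro ⟨h, h'⟩
    refine ⟨fun x hx => (h x hx).1, Set.Subset.antisymm ?_ fun x hx => ?_⟩
    · rintro _ ⟨x, hx, rfl⟩
      exact (h x hx).2
    · refine ⟨P.conj x (P.inv g), (h' x hx).2, ?_⟩
      simpa only [hP.inv_inv] using (hP.conj_inv_s17 (h' x hx).1).2

theorem inv_mem_normalizer_s17 (hP : IsPartialGroup P) {Q : Set L} {g : L}
    (hg : g ∈ P.normalizer Q) : P.inv g ∈ P.normalizer Q := by
  rw [hP.mem_normalizer_iff] at hg ⊢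
  rw [hP.inv_inv]
  exact hg.symm

end IsPartialGroup

theorem pair_mem_Wrd {H : Set L} {a b : L} (ha : a ∈ H) (hb : b ∈ H) : [a, b] ∈ Wrd H := by
  simp [Wrd, ha, hb]

theorem wInv_mem_Wrd {P : Data L} {H : Set L} (hH : ∀ f ∈ H, P.inv f ∈ H) {w : List L}
    (hw : w ∈ Wrd H) : P.wInv w ∈ Wrd H := by
  intro x hx
  simp only [Data.wInv, List.mem_reverse, List.mem_map] at hx
  obtain ⟨y, hy, rfl⟩ := hx
  exact hH y (hw y hy)

namespace Data.IsSubgroup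

variable {P : Data L} {Q : Set L}

theorem one_mem_s17 (hQ : P.IsSubgroup Q) : P.one ∈ Q :=
  hQ.1.2 [] ⟨by simp [Wrd], hQ.2 (by simp [Wrd])⟩

theorem subset_normalizer_s17 (hP : IsPartialGroup P) (hQ : P.IsSubgroup Q) :
    Q ⊆ P.normalizer Q := by
  have key : ∀ g ∈ Q, ∀ x ∈ Q, x ∈ P.Dconj g ∧ P.conj x g ∈ Q := by
    intro g hg x hx
    have hw : [P.inv g, x, g] ∈ Wrd Q := by simp [Wrd, hQ.1.1 g hg, hx, hg]
    exact ⟨hQ.2 hw, hQ.1.2 _ ⟨hw, hQ.2 hw⟩⟩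
  exact fun g hg => hP.mem_normalizer_iff.2 ⟨key g hg, key _ (hQ.1.1 g hg)⟩

/-- The image of a subgroup under a homomorphism of partial groups is a subgroup. -/
theorem image {P' : Data L'} {β : L → L'} (hQ : P.IsSubgroup Q) (hβ : IsHom P P' β)
    (hinv : ∀ f, P'.inv (β f) = β (P.inv f)) : P'.IsSubgroup (β '' Q) := by
  have lift : ∀ w ∈ Wrd (β '' Q), ∃ u ∈ Wrd Q, u.map β = w := by
    intro w hw
    induction w with
    | nil => exact ⟨[], by simp [Wrd], rfl⟩
    | cons f w ih =>
      obtain ⟨u, hu, rfl⟩ := ih fun x hx => hw x (by simp [hx])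
      obtain ⟨q, hq, rfl⟩ := hw f (by simp)
      exact ⟨q :: u, List.forall_mem_cons.2 ⟨hq, hu⟩, rfl⟩
  refine ⟨⟨?_, ?_⟩, ?_⟩
  · rintro _ ⟨q, hq, rfl⟩
    exact ⟨_, hQ.1.1 q hq, (hinv q).symm⟩
  · rintro w ⟨hw, -⟩
    obtain ⟨u, hu, rfl⟩ := lift w hw
    exact ⟨_, hQ.1.2 u ⟨hu, hQ.2 hu⟩, (hβ.2 u (hQ.2 hu)).symm⟩
  · intro w hw
    obtain ⟨u, hu, rfl⟩ := lift w hw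
    exact hβ.1 u (hQ.2 hu)

end Data.IsSubgroup

namespace IsLocality

variable {p : ℕ} {P : Data L} {Δ : Set (Set L)} {S Q : Set L}

theorem wrd_normalizer_subset (h : IsLocality p P Δ S) (hQ : Q ∈ Δ) :
    Wrd (P.normalizer Q) ⊆ P.D := by
  intro w hw
  rw [h.d_eq]
  refine ⟨Q, hQ, ?_⟩
  induction w with
  | nil => trivial
  | cons f w ih =>
    have hf : f ∈ P.normalizer Q := hw f (by simp)
    refine ⟨hf.1, hf.2.symm ▸ hQ, ?_⟩
    rw [hf.2]
    exact ih fun x hx => hw x (by simp [hx])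

theorem isSubgroup_normalizer_s17 (h : IsLocality p P Δ S) (hQ : Q ∈ Δ) :
    P.IsSubgroup (P.normalizer Q) := by
  have hP := h.isPartialGroup
  have hD := h.wrd_normalizer_subset hQ
  have hQN := (h.delta_subgroups Q hQ).1.subset_normalizer_s17 hP
  have hinv : ∀ f ∈ P.normalizer Q, P.inv f ∈ P.normalizer Q :=
    fun f hf => hP.inv_mem_normalizer_s17 hf
  have hmem : ∀ w ∈ Wrd (P.normalizer Q), ∀ x ∈ Q, P.wInv w ++ [x] ++ w ∈ P.D := by
    intro w hw x hx
    refine hD fun y hy => ?_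
    simp only [List.append_assoc, List.mem_append, List.mem_singleton] at hy
    rcases hy with hy | rfl | hy
    · exact wInv_mem_Wrd hinv hw y hy
    · exact hQN hx
    · exact hw y hy
  have hpi : ∀ w ∈ Wrd (P.normalizer Q), ∀ x ∈ Q, P.pi (P.wInv w ++ [x] ++ w) ∈ Q := by
    intro w
    induction w with
    | nil => intro _ x hx; simpa [Data.wInv, hP.pi_singleton] using hx
    | cons f w ih =>
      intro hw x hx
      have hf := (hP.mem_normalizer_iff.1 (hw f (by simp))).1 x hx
      have hsplit : P.wInv (f :: w) ++ [x] ++ f :: w = P.wInv w ++ [P.inv f, x, f] ++ w := by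
        simp [Data.wInv]
      have hm := hmem _ hw x hx
      rw [hsplit] at hm ⊢
      rw [hP.assoc_pi _ _ _ hm]
      exact ih (fun y hy => hw y (by simp [hy])) _ hf.2
  have key : ∀ w ∈ Wrd (P.normalizer Q), ∀ x ∈ Q,
      x ∈ P.Dconj (P.pi w) ∧ P.conj x (P.pi w) ∈ Q := by
    intro w hw x hx
    have := hP.conj_pi (hmem w hw x hx)
    exact ⟨this.1, this.2.symm ▸ hpi w hw x hx⟩
  refine ⟨⟨hinv, fun w hw => hP.mem_normalizer_iff.2 ⟨key w hw.1, ?_⟩⟩, hD⟩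
  rw [hP.inv_pi hw.2]
  exact key _ (wInv_mem_Wrd hinv hw.1)

theorem mem_delta_of_subset (h : IsLocality p P Δ S) {R : Set L} (hQ : P.IsSubgroup Q)
    (hQS : Q ⊆ S) (hR : R ∈ Δ) (hRQ : R ⊆ Q) : Q ∈ Δ := by
  have : Nonempty L := ⟨P.one⟩
  refine h.delta_closed Q hQ hQS ⟨R, hR, P.one,
    fun x _ => (h.isPartialGroup.conj_one_s17 x).1, ?_⟩
  rintro _ ⟨x, hx, rfl⟩
  exact (congrArg (· ∈ Q) (h.isPartialGroup.conj_one_s17 x).2).mpr (hRQ hx)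

end IsLocality

/-- `φ` identifies the group `G` with the subgroup `M` of the partial group `P`. -/
structure Realizes {G : Type*} [Group G] (P : Data L) (M : Set L) (φ : G → L) : Prop where
  injective : Function.Injective φ
  range_eq : Set.range φ = M
  map_mem : ∀ l : List G, l.map φ ∈ P.D
  pi_map : ∀ l : List G, P.pi (l.map φ) = φ l.prod
  inv_map : ∀ g : G, P.inv (φ g) = φ g⁻¹

/-- Every subgroup of a partial group is a group under the restricted product. -/
theorem Data.IsSubgroup.exists_realizes.{u} {L : Type u} {P : Data L} {M : Set L}
    (hP : IsPartialGroup P) (hM : P.IsSubgroup M) :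
    ∃ (G : Type u) (_ : Group G) (φ : G → L), Realizes P M φ := by
  have mem₂ {a b : L} (ha : a ∈ M) (hb : b ∈ M) : [a, b] ∈ P.D := hM.2 (pair_mem_Wrd ha hb)
  let _ : Mul M := ⟨fun a b => ⟨P.pi [a, b], hM.1.2 _ ⟨pair_mem_Wrd a.2 b.2, mem₂ a.2 b.2⟩⟩⟩
  let _ : One M := ⟨⟨P.one, hM.one_mem_s17⟩⟩
  let _ : Inv M := ⟨fun a => ⟨P.inv a, hM.1.1 a a.2⟩⟩
  let _ : Group M := Group.ofLeftAxioms
    (fun a b c => by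
      have h : [(a : L), b, c] ∈ P.D := hM.2 (by simp [Wrd])
      have e₁ := hP.assoc_pi [] [(a : L), b] [(c : L)] h
      have e₂ := hP.assoc_pi [(a : L)] [(b : L), c] [] h
      exact Subtype.ext (e₁.symm.trans e₂))
    (fun a => Subtype.ext
      ((hP.one_cons_s17 (hP.singleton_mem (a : L))).2.trans (hP.pi_singleton _)))
    (fun a => Subtype.ext (hP.inv_pair (a : L)).2)
  have hD : ∀ l : List M, l.map Subtype.val ∈ P.D := fun l => hM.2 fun x hx => by
    obtain ⟨y, -, rfl⟩ := List.mem_map.1 hx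
    exact y.2
  refine ⟨M, inferInstance, Subtype.val, Subtype.val_injective, Subtype.range_val, hD,
    fun l => ?_, fun g => rfl⟩
  induction l with
  | nil => rfl
  | cons a l ih =>
    have h : [(a : L)] ++ l.map Subtype.val ++ [] ∈ P.D := by simpa using hD (a :: l)
    have e := hP.assoc_pi _ _ _ h
    rw [ih, List.append_nil] at e
    rw [List.prod_cons]
    exact e

namespace Realizes

variable {p : ℕ} {G G₁ G₂ : Type*} [Group G] [Group G₁] [Group G₂] {P : Data L} {M : Set L}
  {φ : G → L}

theorem map_one (h : Realizes P M φ) : φ 1 = P.one := (h.pi_map []).symm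

theorem mem (h : Realizes P M φ) (g : G) : φ g ∈ M := h.range_eq ▸ ⟨g, rfl⟩

theorem prod {P₁ : Data L₁} {P₂ : Data L₂} {M₁ : Set L₁} {M₂ : Set L₂} {φ₁ : G₁ → L₁}
    {φ₂ : G₂ → L₂} (h₁ : Realizes P₁ M₁ φ₁) (h₂ : Realizes P₂ M₂ φ₂) :
    Realizes (prodData P₁ P₂) (M₁ ×ˢ M₂) (Prod.map φ₁ φ₂) where
  injective := h₁.injective.prodMap h₂.injective
  range_eq := by rw [Set.range_prodMap, h₁.range_eq, h₂.range_eq]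
  map_mem l := by
    have m₁ := h₁.map_mem (l.map Prod.fst)
    have m₂ := h₂.map_mem (l.map Prod.snd)
    rw [List.map_map] at m₁ m₂
    refine ⟨?_, ?_⟩ <;> rw [List.map_map] <;> assumption
  pi_map l := by
    have e₁ := h₁.pi_map (l.map Prod.fst)
    have e₂ := h₂.pi_map (l.map Prod.snd)
    rw [List.map_map] at e₁ e₂
    have f₁ := map_list_prod (MonoidHom.fst G₁ G₂) l
    have f₂ := map_list_prod (MonoidHom.snd G₁ G₂) l
    simp only [MonoidHom.coe_fst, MonoidHom.coe_snd] at f₁ f₂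
    refine Prod.ext ?_ ?_
    · change P₁.pi ((l.map _).map Prod.fst) = φ₁ l.prod.1
      rw [List.map_map, f₁]; exact e₁
    · change P₂.pi ((l.map _).map Prod.snd) = φ₂ l.prod.2
      rw [List.map_map, f₂]; exact e₂
  inv_map g := Prod.ext (h₁.inv_map g.1) (h₂.inv_map g.2)

theorem restrict (h : Realizes P M φ) (H : Subgroup G) :
    Realizes P (φ '' H) fun g : H => φ g where
  injective := h.injective.comp Subtype.val_injective
  range_eq := by ext; simp
  map_mem l := by
    have := h.map_mem (l.map Subtype.val)
    rwa [List.map_map] at this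
  pi_map l := by
    have := h.pi_map (l.map Subtype.val)
    rw [List.map_map] at this
    rw [← Subgroup.subtype_apply, map_list_prod]
    exact this
  inv_map g := h.inv_map g

theorem isSubgroup (h : Realizes P M φ) : P.IsSubgroup M := by
  have lift : ∀ w ∈ Wrd M, ∃ l : List G, l.map φ = w := fun w hw =>
    (Set.mem_range.1 (Set.range_list_map φ ▸ fun x hx => h.range_eq ▸ hw x hx))
  refine ⟨⟨fun f hf => ?_, fun w hw => ?_⟩, fun w hw => ?_⟩
  · rw [← h.range_eq] at hf
    obtain ⟨g, rfl⟩ := hf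
    exact h.inv_map g ▸ h.mem _
  · obtain ⟨l, rfl⟩ := lift w hw.1
    exact h.pi_map l ▸ h.mem _
  · obtain ⟨l, rfl⟩ := lift w hw
    exact h.map_mem l

theorem exists_subgroup (h : Realizes P M φ) {K : Set L} (hK : P.IsSubgroup K) (hKM : K ⊆ M) :
    ∃ H : Subgroup G, φ '' H = K := by
  refine ⟨⟨⟨⟨φ ⁻¹' K, ?_⟩, ?_⟩, ?_⟩, ?_⟩
  · intro a b ha hb
    have := hK.1.2 [φ a, φ b] ⟨pair_mem_Wrd ha hb, hK.2 (pair_mem_Wrd ha hb)⟩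
    rw [show [φ a, φ b] = [a, b].map φ from rfl, h.pi_map] at this
    simpa using this
  · exact Set.mem_preimage.2 (h.map_one ▸ hK.one_mem_s17)
  · intro a ha
    exact Set.mem_preimage.2 (h.inv_map a ▸ hK.1.1 _ ha)
  · exact Set.image_preimage_eq_of_subset (h.range_eq ▸ hKM)

theorem mem_Dconj (h : Realizes P M φ) (x g : G) : φ x ∈ P.Dconj (φ g) := by
  have := h.map_mem [g⁻¹, x, g]
  simpa [Data.Dconj, h.inv_map] using this

theorem conj_map (h : Realizes P M φ) (x g : G) :
    P.conj (φ x) (φ g) = φ (g⁻¹ * x * g) := by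
  have := h.pi_map [g⁻¹, x, g]
  simpa [Data.conj, h.inv_map, mul_assoc] using this

theorem image_normalizer (h : Realizes P M φ) (H : Subgroup G) :
    φ '' (Subgroup.normalizer (H : Set G)) = P.normalizer (φ '' H) ∩ M := by
  ext x
  constructor
  · rintro ⟨g, hg, rfl⟩
    refine ⟨⟨?_, ?_⟩, h.mem g⟩
    · rintro _ ⟨x, -, rfl⟩
      exact h.mem_Dconj x g
    · rw [SetLike.mem_coe, Subgroup.mem_normalizer_iff''] at hg
      apply Set.Subset.antisymm
      · rintro _ ⟨_, ⟨x, hx, rfl⟩, rfl⟩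
        exact ⟨_, (hg x).1 hx, (h.conj_map x g).symm⟩
      · rintro _ ⟨x, hx, rfl⟩
        refine ⟨φ (g * x * g⁻¹), ⟨_, ?_, rfl⟩, ?_⟩
        · rw [SetLike.mem_coe, hg]
          simpa [mul_assoc] using hx
        · simp only [h.conj_map]
          simp [mul_assoc]
  · rintro ⟨⟨-, hx⟩, hxM⟩
    rw [← h.range_eq] at hxM
    obtain ⟨g, rfl⟩ := hxM
    refine ⟨g, ?_, rfl⟩
    rw [SetLike.mem_coe, Subgroup.mem_normalizer_iff'']
    have key : ∀ y : G, φ (g⁻¹ * y * g) ∈ P.conjSet (φ '' H) (φ g) ↔ y ∈ H := by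
      intro y
      constructor
      · rintro ⟨_, ⟨z, hz, rfl⟩, e⟩
        have e' := h.injective ((h.conj_map z g).symm.trans e)
        simpa [show z = y by simpa using e'] using hz
      · exact fun hy => ⟨φ y, ⟨y, hy, rfl⟩, h.conj_map y g⟩
    intro y
    rw [← key y, hx, h.injective.mem_set_image]
    rfl

theorem isNormalPSubgroupIn_image [Fact p.Prime] [Finite G] (h : Realizes P M φ)
    (H : Subgroup G) :
    P.IsNormalPSubgroupIn p M (φ '' H) ↔ H.Normal ∧ IsPGroup p H := by
  have hcard : (φ '' H).ncard = Nat.card H := by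
    rw [Set.ncard_image_of_injective _ h.injective]; rfl
  have hsub : φ '' H ⊆ M := by rintro _ ⟨g, -, rfl⟩; exact h.mem g
  rw [IsPGroup.iff_card, ← hcard]
  constructor
  · rintro ⟨-, -, hc, hn⟩
    refine ⟨⟨fun n hnH g => ?_⟩, hc⟩
    have := (hn (φ g⁻¹) (h.mem _) (φ n) ⟨n, hnH, rfl⟩).2
    rw [h.conj_map, h.injective.mem_set_image] at this
    simpa using this
  · rintro ⟨hn, hc⟩
    refine ⟨hsub, (h.restrict H).isSubgroup, hc, ?_⟩
    rintro f hf _ ⟨x, hx, rfl⟩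
    rw [← h.range_eq] at hf
    obtain ⟨g, rfl⟩ := hf
    refine ⟨h.mem_Dconj x g, ?_⟩
    rw [h.conj_map, h.injective.mem_set_image]
    simpa using hn.conj_mem x hx g⁻¹

theorem pCoreIn_eq [Fact p.Prime] [Finite G] (h : Realizes P M φ) :
    P.pCoreIn p M = φ '' pCore p G := by
  ext x
  constructor
  · rintro ⟨K, hK, hx⟩
    obtain ⟨H, rfl⟩ := h.exists_subgroup hK.2.1 hK.1
    obtain ⟨g, hg, rfl⟩ := hx
    obtain ⟨hn, hp⟩ := (h.isNormalPSubgroupIn_image H).1 hK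
    exact ⟨g, le_pCore hn hp hg, rfl⟩
  · rintro ⟨g, ⟨H, hH, hp, hg⟩, rfl⟩
    exact ⟨φ '' H, (h.isNormalPSubgroupIn_image H).2 ⟨hH, hp⟩, g, hg, rfl⟩

theorem isCharPSubgroup_iff [Fact p.Prime] [Finite G] (h : Realizes P M φ) :
    P.IsCharPSubgroup p M ↔ IsCharPGroup p G := by
  have hc : P.centralizerIn M (P.pCoreIn p M) =
      φ '' Subgroup.centralizer (pCore p G : Set G) := by
    rw [h.pCoreIn_eq]
    ext x
    constructor
    · rintro ⟨hxM, hx⟩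
      rw [← h.range_eq] at hxM
      obtain ⟨g, rfl⟩ := hxM
      refine ⟨g, Subgroup.mem_centralizer_iff.2 fun y hy => ?_, rfl⟩
      have := h.injective ((h.conj_map y g).symm.trans (hx _ ⟨y, hy, rfl⟩).2)
      rwa [mul_assoc, inv_mul_eq_iff_eq_mul] at this
    · rintro ⟨g, hg, rfl⟩
      refine ⟨h.mem g, ?_⟩
      rintro _ ⟨y, hy, rfl⟩
      refine ⟨h.mem_Dconj y g, ?_⟩
      rw [h.conj_map, mul_assoc, Subgroup.mem_centralizer_iff.1 hg y hy, inv_mul_cancel_left]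
  rw [Data.IsCharPSubgroup, hc, h.pCoreIn_eq, Set.image_subset_image_iff h.injective]
  rfl

theorem isPGroup [Fact p.Prime] [Finite L] (h : Realizes P M φ) {S : Set L}
    (hP : IsPartialGroup P) (hS : P.IsPSubgroup p S) {H : Subgroup G} (hH : φ '' H ⊆ S) :
    IsPGroup p H := by
  obtain ⟨T, _, ψ, hψ⟩ := hS.1.exists_realizes hP
  have : Finite T := Finite.of_injective ψ hψ.injective
  have hT : IsPGroup p T := by
    obtain ⟨n, hn⟩ := hS.2
    refine IsPGroup.of_card (n := n) ?_
    rw [← hn, ← hψ.range_eq]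
    exact (Set.ncard_range_of_injective hψ.injective).symm
  rintro ⟨g, hg⟩
  have hgS : φ g ∈ S := hH ⟨g, hg, rfl⟩
  rw [← hψ.range_eq] at hgS
  obtain ⟨t, ht⟩ := hgS
  obtain ⟨k, hk⟩ := hT t
  have e₁ := hψ.pi_map (List.replicate (p ^ k) t)
  have e₂ := h.pi_map (List.replicate (p ^ k) g)
  rw [List.map_replicate, List.prod_replicate] at e₁ e₂
  rw [ht, hk, e₂, hψ.map_one, ← h.map_one] at e₁
  exact ⟨k, Subtype.ext (h.injective e₁)⟩

theorem le_pCore_of_image_eq [Fact p.Prime] [Finite L] {Q S : Set L} {φ : G → L}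
    (h : Realizes P (P.normalizer Q) φ) (hP : IsPartialGroup P) (hS : P.IsPSubgroup p S)
    {H : Subgroup G} (hH : φ '' H = Q) (hQS : Q ⊆ S) : H ≤ pCore p G := by
  refine le_pCore ⟨fun n hn g => ?_⟩ (h.isPGroup hP hS (hH ▸ hQS))
  have hconj : P.conj (φ n) (φ g⁻¹) ∈ φ '' H := by
    rw [hH, ← (h.mem g⁻¹).2]
    exact ⟨φ n, hH ▸ ⟨n, hn, rfl⟩, rfl⟩
  rw [h.conj_map, h.injective.mem_set_image] at hconj
  simpa using hconj

end Realizes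

section Prod

variable {P₁ : Data L₁} {P₂ : Data L₂}

theorem isSubgroup_image_fst {Q : Set (L₁ × L₂)} (hQ : (prodData P₁ P₂).IsSubgroup Q) :
    P₁.IsSubgroup (Prod.fst '' Q) :=
  hQ.image ⟨fun _ hw => hw.1, fun _ _ => rfl⟩ fun _ => rfl

theorem isSubgroup_image_snd {Q : Set (L₁ × L₂)} (hQ : (prodData P₁ P₂).IsSubgroup Q) :
    P₂.IsSubgroup (Prod.snd '' Q) :=
  hQ.image ⟨fun _ hw => hw.2, fun _ _ => rfl⟩ fun _ => rfl

theorem isSubgroup_prod {Q₁ : Set L₁} {Q₂ : Set L₂} (h₁ : P₁.IsSubgroup Q₁)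
    (h₂ : P₂.IsSubgroup Q₂) : (prodData P₁ P₂).IsSubgroup (Q₁ ×ˢ Q₂) := by
  have wrd : ∀ w ∈ Wrd (Q₁ ×ˢ Q₂), w.map Prod.fst ∈ Wrd Q₁ ∧ w.map Prod.snd ∈ Wrd Q₂ := by
    intro w hw
    constructor <;> intro x hx <;> obtain ⟨q, hq, rfl⟩ := List.mem_map.1 hx
    · exact (hw q hq).1
    · exact (hw q hq).2
  refine ⟨⟨fun f hf => ⟨h₁.1.1 _ hf.1, h₂.1.1 _ hf.2⟩, fun w hw => ?_⟩, fun w hw => ?_⟩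
  · obtain ⟨w₁, w₂⟩ := wrd w hw.1
    exact ⟨h₁.1.2 _ ⟨w₁, h₁.2 w₁⟩, h₂.1.2 _ ⟨w₂, h₂.2 w₂⟩⟩
  · obtain ⟨w₁, w₂⟩ := wrd w hw
    exact ⟨h₁.2 w₁, h₂.2 w₂⟩

theorem normalizer_subset_prod (Q : Set (L₁ × L₂)) :
    (prodData P₁ P₂).normalizer Q ⊆
      P₁.normalizer (Prod.fst '' Q) ×ˢ P₂.normalizer (Prod.snd '' Q) := by
  rintro g ⟨hD, hQ⟩
  refine ⟨⟨?_, ?_⟩, ⟨?_, ?_⟩⟩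
  · rintro _ ⟨q, hq, rfl⟩
    exact (hD hq).1
  · conv_rhs => rw [← hQ]
    simp only [Data.conjSet, Set.image_image]
    rfl
  · rintro _ ⟨q, hq, rfl⟩
    exact (hD hq).2
  · conv_rhs => rw [← hQ]
    simp only [Data.conjSet, Set.image_image]
    rfl

theorem normalizer_prod {Q₁ : Set L₁} {Q₂ : Set L₂} (h₁ : Q₁.Nonempty) (h₂ : Q₂.Nonempty) :
    (prodData P₁ P₂).normalizer (Q₁ ×ˢ Q₂) = P₁.normalizer Q₁ ×ˢ P₂.normalizer Q₂ := by
  apply Set.Subset.antisymm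
  · simpa only [Set.fst_image_prod _ h₂, Set.snd_image_prod h₁] using
      normalizer_subset_prod (P₁ := P₁) (P₂ := P₂) (Q₁ ×ˢ Q₂)
  · rintro g ⟨⟨hD₁, hQ₁⟩, ⟨hD₂, hQ₂⟩⟩
    refine ⟨fun q hq => ⟨hD₁ hq.1, hD₂ hq.2⟩, ?_⟩
    conv_rhs => rw [← hQ₁, ← hQ₂]
    exact (Set.prodMap_image_prod (fun x => P₁.conj x g.1) (fun x => P₂.conj x g.2) Q₁ Q₂)

end Prod

/-- Lemma 5.6: the external direct product locality `(L₁ × L₂, Δ₁*Δ₂, S₁ × S₂)` is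
of objective characteristic `p` if and only if each `(L_i,Δ_i,S_i)` is of objective
characteristic `p`. -/
theorem prod_objectiveCharP (p : ℕ) (hp : p.Prime)
    (P₁ : Data L₁) (Δ₁ : Set (Set L₁)) (S₁ : Set L₁)
    (P₂ : Data L₂) (Δ₂ : Set (Set L₂)) (S₂ : Set L₂)
    (h₁ : IsLocality p P₁ Δ₁ S₁) (h₂ : IsLocality p P₂ Δ₂ S₂) :
    IsObjectiveCharP p (prodData P₁ P₂) (deltaStar P₁ P₂ Δ₁ Δ₂ S₁ S₂) ↔
      IsObjectiveCharP p P₁ Δ₁ ∧ IsObjectiveCharP p P₂ Δ₂ := by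
  have : Fact p.Prime := ⟨hp⟩
  have := h₁.finite
  have := h₂.finite
  constructor
  · intro h
    have key : ∀ Q₁ ∈ Δ₁, ∀ Q₂ ∈ Δ₂, P₁.IsCharPSubgroup p (P₁.normalizer Q₁) ∧
        P₂.IsCharPSubgroup p (P₂.normalizer Q₂) := by
      intro Q₁ hQ₁ Q₂ hQ₂
      obtain ⟨hs₁, hS₁⟩ := h₁.delta_subgroups Q₁ hQ₁
      obtain ⟨hs₂, hS₂⟩ := h₂.delta_subgroups Q₂ hQ₂
      obtain ⟨G₁, _, φ₁, hφ₁⟩ :=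
        (h₁.isSubgroup_normalizer_s17 hQ₁).exists_realizes h₁.isPartialGroup
      obtain ⟨G₂, _, φ₂, hφ₂⟩ :=
        (h₂.isSubgroup_normalizer_s17 hQ₂).exists_realizes h₂.isPartialGroup
      have : Finite G₁ := Finite.of_injective φ₁ hφ₁.injective
      have : Finite G₂ := Finite.of_injective φ₂ hφ₂.injective
      have hQ := h (Q₁ ×ˢ Q₂) ⟨isSubgroup_prod hs₁ hs₂, Set.prod_mono hS₁ hS₂, Q₁, hQ₁, Q₂, hQ₂,
        Set.Subset.rfl⟩
      rw [normalizer_prod ⟨_, hs₁.one_mem_s17⟩ ⟨_, hs₂.one_mem_s17⟩,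
        (hφ₁.prod hφ₂).isCharPSubgroup_iff, isCharPGroup_prod] at hQ
      rwa [hφ₁.isCharPSubgroup_iff, hφ₂.isCharPSubgroup_iff]
    obtain ⟨R₁, hR₁⟩ := h₁.delta_nonempty
    obtain ⟨R₂, hR₂⟩ := h₂.delta_nonempty
    exact ⟨fun Q hQ => (key Q hQ R₂ hR₂).1, fun Q hQ => (key R₁ hR₁ Q hQ).2⟩
  · rintro ⟨hc₁, hc₂⟩ Q ⟨hQ, hQS, R₁, hR₁, R₂, hR₂, hRQ⟩
    have hs₁ := isSubgroup_image_fst hQ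
    have hs₂ := isSubgroup_image_snd hQ
    have hS₁ : Prod.fst '' Q ⊆ S₁ := Set.image_subset_iff.2 fun q hq => (hQS hq).1
    have hS₂ : Prod.snd '' Q ⊆ S₂ := Set.image_subset_iff.2 fun q hq => (hQS hq).2
    have hQ₁ : Prod.fst '' Q ∈ Δ₁ := h₁.mem_delta_of_subset hs₁ hS₁ hR₁ fun x hx =>
      ⟨(x, P₂.one), hRQ ⟨hx, (h₂.delta_subgroups R₂ hR₂).1.one_mem_s17⟩, rfl⟩
    have hQ₂ : Prod.snd '' Q ∈ Δ₂ := h₂.mem_delta_of_subset hs₂ hS₂ hR₂ fun x hx =>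
      ⟨(P₁.one, x), hRQ ⟨(h₁.delta_subgroups R₁ hR₁).1.one_mem_s17, hx⟩, rfl⟩
    obtain ⟨G₁, _, φ₁, hφ₁⟩ :=
      (h₁.isSubgroup_normalizer_s17 hQ₁).exists_realizes h₁.isPartialGroup
    obtain ⟨G₂, _, φ₂, hφ₂⟩ :=
      (h₂.isSubgroup_normalizer_s17 hQ₂).exists_realizes h₂.isPartialGroup
    have : Finite G₁ := Finite.of_injective φ₁ hφ₁.injective
    have : Finite G₂ := Finite.of_injective φ₂ hφ₂.injective
    have hφ := hφ₁.prod hφ₂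
    have hn₁ := hs₁.subset_normalizer_s17 h₁.isPartialGroup
    have hn₂ := hs₂.subset_normalizer_s17 h₂.isPartialGroup
    have hG : IsCharPGroup p (G₁ × G₂) := isCharPGroup_prod.2
      ⟨hφ₁.isCharPSubgroup_iff.1 (hc₁ _ hQ₁), hφ₂.isCharPSubgroup_iff.1 (hc₂ _ hQ₂)⟩
    obtain ⟨H, hH⟩ := hφ.exists_subgroup hQ
      fun q hq => ⟨hn₁ ⟨q, hq, rfl⟩, hn₂ ⟨q, hq, rfl⟩⟩
    obtain ⟨H₁, hH₁⟩ := hφ₁.exists_subgroup hs₁ hn₁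
    obtain ⟨H₂, hH₂⟩ := hφ₂.exists_subgroup hs₂ hn₂
    have hle₁ : H₁ ≤ pCore p G₁ := hφ₁.le_pCore_of_image_eq h₁.isPartialGroup h₁.pSubgroup hH₁ hS₁
    have hle₂ : H₂ ≤ pCore p G₂ := hφ₂.le_pCore_of_image_eq h₂.isPartialGroup h₂.pSubgroup hH₂ hS₂
    have hle : H ≤ pCore p (G₁ × G₂) := by
      intro g hg
      have hgQ : Prod.map φ₁ φ₂ g ∈ Q := hH ▸ ⟨g, hg, rfl⟩
      have hg₁ : φ₁ g.1 ∈ φ₁ '' H₁ := hH₁ ▸ ⟨_, hgQ, rfl⟩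
      have hg₂ : φ₂ g.2 ∈ φ₂ '' H₂ := hH₂ ▸ ⟨_, hgQ, rfl⟩
      rw [hφ₁.injective.mem_set_image] at hg₁
      rw [hφ₂.injective.mem_set_image] at hg₂
      exact mem_pCore_prod.2 ⟨hle₁ hg₁, hle₂ hg₂⟩
    have hN := hφ.restrict (Subgroup.normalizer (H : Set (G₁ × G₂)))
    rw [hφ.image_normalizer, hH, Set.inter_eq_left.2 (normalizer_subset_prod Q)] at hN
    exact hN.isCharPSubgroup_iff.2 (hG.normalizer hle)

end PartialGroups
end
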